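/- arXiv:1509.09210 — 4 statements merged into one kernel-verified Lean document; each statement's English description precedes it below -/
import Mathlib

section
/- Let k be a positive integer, let α be a positive integer, and let p and p' be two α-compatible sequences of non-negative integers of the same length n such that the trees T_α(p) and T_α(p') are not isomorphic. Then T_α(p) and T_α(p') have the same U_{k+1}-polynomial if and only if p =_k p', i.e. the sequences p and p' form a solution of the Prouhet–Tarry–Escott problem of degree k. -/
open scoped Classical

/-- `a =_k b` : the power sums of orders `1,…,k` of the two sequences agree. -/
def PTErel (k : ℕ) {n : ℕ} {R : Type*} [CommSemiring R] (a b : Fin n → R) : Prop :=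
  ∀ ℓ : ℕ, 1 ≤ ℓ → ℓ ≤ k → ∑ i, (a i) ^ ℓ = ∑ i, (b i) ^ ℓ

/-- The multiset of sizes of the connected components of a finite graph. -/
noncomputable def componentSizes {V : Type} [Fintype V] (H : SimpleGraph V) : Multiset ℕ :=
  (Finset.univ : Finset H.ConnectedComponent).val.map fun c => Nat.card c.supp

/-- The `U_k`-polynomial of a graph, encoded as the multiset of partitions
`λ(E \ A)` over all edge subsets `A` with `|A| ≤ k`.  Two graphs have the same
`U_k`-polynomial iff these multisets coincide. -/
noncomputable def UkPoly {V : Type} [Fintype V] (G : SimpleGraph V) (k : ℕ) :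
    Multiset (Multiset ℕ) :=
  (G.edgeFinset.powerset.filter fun A => A.card ≤ k).val.map fun A =>
    componentSizes (G.deleteEdges ↑A)

/-- The `U`-polynomial of a graph, encoded as the multiset of partitions
`λ(E \ A)` over all edge subsets `A`. -/
noncomputable def UPoly {V : Type} [Fintype V] (G : SimpleGraph V) :
    Multiset (Multiset ℕ) :=
  G.edgeFinset.powerset.val.map fun A => componentSizes (G.deleteEdges ↑A)

/-- Vertex type for the tree `T(p,s)`: a central vertex, roots `v_1,…,v_n`, and for
each `i` the extra vertices of `p i` copies of a 4-vertex path and `s i` copies of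
a 4-vertex star (3 extra vertices each, the remaining leaf being identified with
the root `v_i`). -/
abbrev Vtx (n : ℕ) (p s : Fin n → ℕ) : Type :=
  Unit ⊕ Fin n ⊕ ((Σ i : Fin n, Fin (p i) × Fin 3) ⊕ (Σ i : Fin n, Fin (s i) × Fin 3))

/-- Edges of `T(p,s)`: the central vertex is joined to each root `v_i`; each copy of
a 4-vertex path hangs from `v_i` as `v_i — x₀ — x₁ — x₂`; each copy of a 4-vertex
star hangs from `v_i` as `v_i — y₀` with extra leaves `y₁, y₂` adjacent to `y₀`. -/
inductive TRel (n : ℕ) (p s : Fin n → ℕ) : Vtx n p s → Vtx n p s → Prop where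
  | core (i : Fin n) :
      TRel n p s (Sum.inl ()) (Sum.inr (Sum.inl i))
  | pathRoot (i : Fin n) (j : Fin (p i)) :
      TRel n p s (Sum.inr (Sum.inl i)) (Sum.inr (Sum.inr (Sum.inl ⟨i, j, 0⟩)))
  | pathEdge (i : Fin n) (j : Fin (p i)) (l : Fin 2) :
      TRel n p s (Sum.inr (Sum.inr (Sum.inl ⟨i, j, l.castSucc⟩)))
        (Sum.inr (Sum.inr (Sum.inl ⟨i, j, l.succ⟩)))
  | starRoot (i : Fin n) (j : Fin (s i)) :
      TRel n p s (Sum.inr (Sum.inl i)) (Sum.inr (Sum.inr (Sum.inr ⟨i, j, 0⟩)))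
  | starEdge (i : Fin n) (j : Fin (s i)) (l : Fin 2) :
      TRel n p s (Sum.inr (Sum.inr (Sum.inr ⟨i, j, 0⟩)))
        (Sum.inr (Sum.inr (Sum.inr ⟨i, j, l.succ⟩)))

/-- The tree `T(p,s)`. -/
def TpsGraph (n : ℕ) (p s : Fin n → ℕ) : SimpleGraph (Vtx n p s) :=
  SimpleGraph.fromRel (TRel n p s)

/-- The PTE-tree `T_α(p) = T(p, α - p)`. -/
def Ttree (α : ℕ) {n : ℕ} (p : Fin n → ℕ) : SimpleGraph (Vtx n p (fun i => α - p i)) :=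
  TpsGraph n p (fun i => α - p i)

/-- `p` is an `α`-compatible sequence: it has length `n ≥ 2` and all entries `≤ α`. -/
def AlphaCompatible (α : ℕ) {n : ℕ} (p : Fin n → ℕ) : Prop :=
  2 ≤ n ∧ ∀ i, p i ≤ α

section

open Finset

theorem map_val_eq_sum_singleton {ι β : Type*} (S : Finset ι) (f : ι → β) :
    S.val.map f = ∑ a ∈ S, {f a} := by
  rw [Finset.sum, ← Multiset.sum_map_singleton (S.val.map f), Multiset.map_map]
  rfl

/-- If the edges of a graph join each non-`isTop` vertex to its parent, then its components are
indexed by the `isTop` vertices. -/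
theorem componentSizes_eq_of_parent {V : Type} [Fintype V] [DecidableEq V]
    (H : SimpleGraph V) (par top : V → V)
    (isTop : V → Prop) [DecidablePred isTop] (depth : V → ℕ)
    (hdepth : ∀ v, ¬ isTop v → depth (par v) < depth v)
    (hadj : ∀ u v, H.Adj u v ↔ (¬ isTop v ∧ par v = u) ∨ (¬ isTop u ∧ par u = v))
    (htop : ∀ v, isTop v → top v = v) (htop' : ∀ v, ¬ isTop v → top v = top (par v)) :
    componentSizes H = ∑ r, if isTop r then {∑ v, if top v = r then 1 else 0} else 0 := by
  have main : ∀ m, ∀ v, depth v = m → isTop (top v) ∧ H.Reachable v (top v) := by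
    intro m
    induction m using Nat.strong_induction_on with
    | _ m ih =>
      intro v hv
      by_cases h : isTop v
      · rw [htop v h]
        exact ⟨h, SimpleGraph.Reachable.refl v⟩
      · obtain ⟨h1, h2⟩ := ih _ (hv ▸ hdepth v h) (par v) rfl
        rw [htop' v h]
        exact ⟨h1, (SimpleGraph.Adj.reachable ((hadj v (par v)).2 (Or.inr ⟨h, rfl⟩))).trans h2⟩
  have hreach : ∀ u v, H.Reachable u v ↔ top u = top v := by
    intro u v
    constructor
    · rintro ⟨w⟩
      induction w with
      | nil => rfl
      | cons h _ ih =>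
        rw [← ih]
        rcases (hadj _ _).1 h with ⟨h1, h2⟩ | ⟨h1, h2⟩
        · rw [htop' _ h1, h2]
        · rw [htop' _ h1, h2]
    · intro h
      exact (main _ u rfl).2.trans (h ▸ (main _ v rfl).2.symm)
  have hinj : Set.InjOn H.connectedComponentMk ((univ.filter isTop : Finset V) : Set V) := by
    intro a ha b hb hab
    have := (hreach a b).1 (SimpleGraph.ConnectedComponent.exact hab)
    rwa [htop a (by simpa using ha), htop b (by simpa using hb)] at this
  have himg : ∀ _ : Fintype H.ConnectedComponent, (univ : Finset H.ConnectedComponent) =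
      (univ.filter isTop).image H.connectedComponentMk := by
    intro _
    ext c
    simp only [mem_univ, mem_image, mem_filter, true_and, true_iff]
    induction c using SimpleGraph.ConnectedComponent.ind with
    | _ v => exact ⟨top v, (main _ v rfl).1,
        SimpleGraph.ConnectedComponent.sound (main _ v rfl).2.symm⟩
  rw [componentSizes, himg, image_val_of_injOn hinj, Multiset.map_map, ← Finset.sum_filter,
    map_val_eq_sum_singleton]
  refine Finset.sum_congr rfl fun r hr => ?_
  have hr' : isTop r := (mem_filter.1 hr).2
  rw [Function.comp_apply, Nat.card_eq_fintype_card, Fintype.card_subtype, Finset.card_filter]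
  congr 1
  refine Finset.sum_congr rfl fun v _ => ?_
  have : v ∈ (H.connectedComponentMk r).supp ↔ top v = r := by
    rw [SimpleGraph.ConnectedComponent.mem_supp_iff, SimpleGraph.ConnectedComponent.eq,
      hreach, htop r hr']
  simp only [this]

/-- The edges of one hanging copy are indexed by their lower ends; `branchTop star B l` is the
top vertex of the piece containing `l` once the edges in `B` are cut, `none` if that piece
contains the root. -/
def branchTop (star : Bool) (B : Finset (Fin 3)) (l : Fin 3) : Option (Fin 3) :=
  if l ∈ B then some l
  else if l = 0 then none
  else if l = 2 ∧ star = false ∧ 1 ∈ B then some 1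
  else if 0 ∈ B then some 0
  else none

/-- The number of non-root vertices of a copy that stay attached to the root. -/
def branchRest (star : Bool) (B : Finset (Fin 3)) : ℕ :=
  ∑ l, if branchTop star B l = none then 1 else 0

/-- The sizes of the pieces of a copy cut off from the root. -/
def branchParts (star : Bool) (B : Finset (Fin 3)) : Multiset ℕ :=
  ∑ l, if l ∈ B then {∑ l', if branchTop star B l' = some l then 1 else 0} else 0

/-- A set of cut edges at one root: whether the edge to the centre is cut, and which edges are cut
in each path and in each star. -/
abbrev RootCut (a b : ℕ) : Type :=
  Bool × (Fin a → Finset (Fin 3)) × (Fin b → Finset (Fin 3))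

/-- A set of cut edges of `T(p,s)`. -/
abbrev CutData (n : ℕ) (p s : Fin n → ℕ) : Type := ∀ i : Fin n, RootCut (p i) (s i)

/-- The number of vertices below a root that stay attached to it. -/
def rootRest {a b : ℕ} (c : RootCut a b) : ℕ :=
  ∑ j, branchRest false (c.2.1 j) + ∑ j, branchRest true (c.2.2 j)

/-- The sizes of the pieces cut off below a root. -/
def rootParts {a b : ℕ} (c : RootCut a b) : Multiset ℕ :=
  ∑ j, branchParts false (c.2.1 j) + ∑ j, branchParts true (c.2.2 j)

/-- The size of the component of the central vertex. -/
def centerSize {n : ℕ} {p s : Fin n → ℕ} (γ : CutData n p s) : ℕ :=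
  1 + ∑ i, if (γ i).1 then 0 else 1 + rootRest (γ i)

/-- The sizes of the components that avoid the central vertex. -/
def otherParts {n : ℕ} {p s : Fin n → ℕ} (γ : CutData n p s) : Multiset ℕ :=
  ∑ i, ((if (γ i).1 then {1 + rootRest (γ i)} else 0) + rootParts (γ i))

namespace Vtx

variable {n : ℕ} {p s : Fin n → ℕ}

/-- The parent of a vertex of `T(p,s)` rooted at the central vertex. -/
def par : Vtx n p s → Vtx n p s
  | .inl _ => .inl ()
  | .inr (.inl _) => .inl ()
  | .inr (.inr (.inl ⟨i, j, l⟩)) =>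
    if l = 0 then .inr (.inl i) else .inr (.inr (.inl ⟨i, j, l - 1⟩))
  | .inr (.inr (.inr ⟨i, j, l⟩)) =>
    if l = 0 then .inr (.inl i) else .inr (.inr (.inr ⟨i, j, 0⟩))

/-- A function that increases from parents to children. -/
def depth : Vtx n p s → ℕ
  | .inl _ => 0
  | .inr (.inl _) => 1
  | .inr (.inr (.inl ⟨_, _, l⟩)) => 2 + l
  | .inr (.inr (.inr ⟨_, _, l⟩)) => 2 + l

/-- The edge from the vertex to its parent is cut. -/
def Cut (γ : CutData n p s) : Vtx n p s → Prop
  | .inl _ => False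
  | .inr (.inl i) => (γ i).1 = true
  | .inr (.inr (.inl ⟨i, j, l⟩)) => l ∈ (γ i).2.1 j
  | .inr (.inr (.inr ⟨i, j, l⟩)) => l ∈ (γ i).2.2 j

/-- The top vertex of the component of a root. -/
def rootTop (γ : CutData n p s) (i : Fin n) : Vtx n p s :=
  if (γ i).1 then .inr (.inl i) else .inl ()

/-- The top vertex of the component of a vertex after cutting. -/
def top (γ : CutData n p s) : Vtx n p s → Vtx n p s
  | .inl _ => .inl ()
  | .inr (.inl i) => rootTop γ i
  | .inr (.inr (.inl ⟨i, j, l⟩)) =>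
    (branchTop false ((γ i).2.1 j) l).elim (rootTop γ i) fun l' => .inr (.inr (.inl ⟨i, j, l'⟩))
  | .inr (.inr (.inr ⟨i, j, l⟩)) =>
    (branchTop true ((γ i).2.2 j) l).elim (rootTop γ i) fun l' => .inr (.inr (.inr ⟨i, j, l'⟩))

theorem depth_par_lt (v : Vtx n p s) (hv : v ≠ .inl ()) : depth (par v) < depth v := by
  rcases v with _ | i | ⟨i, j, l⟩ | ⟨i, j, l⟩
  · exact absurd rfl hv
  · simp [depth, par]
  · fin_cases l <;> simp [depth, par]
  · fin_cases l <;> simp [depth, par]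

theorem TRel_iff (u v : Vtx n p s) : TRel n p s u v ↔ v ≠ .inl () ∧ par v = u := by
  constructor
  · rintro (i | ⟨i, j⟩ | ⟨i, j, l⟩ | ⟨i, j⟩ | ⟨i, j, l⟩)
    · simp [par]
    · simp [par]
    · fin_cases l <;> simp [par]
    · simp [par]
    · fin_cases l <;> simp [par]
  · rintro ⟨hv, rfl⟩
    rcases v with _ | i | ⟨i, j, l⟩ | ⟨i, j, l⟩
    · exact absurd rfl hv
    · exact .core i
    · fin_cases l
      · exact .pathRoot i j
      · exact .pathEdge i j 0
      · exact .pathEdge i j 1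
    · fin_cases l
      · exact .starRoot i j
      · exact .starEdge i j 0
      · exact .starEdge i j 1

theorem adj_iff (u v : Vtx n p s) : (TpsGraph n p s).Adj u v ↔
    (v ≠ .inl () ∧ par v = u) ∨ (u ≠ .inl () ∧ par u = v) := by
  rw [TpsGraph, SimpleGraph.fromRel_adj, TRel_iff, TRel_iff]
  refine ⟨fun h => h.2, fun h => ⟨?_, h⟩⟩
  rintro rfl
  rcases h with ⟨h1, h2⟩ | ⟨h1, h2⟩ <;>
  · have := depth_par_lt _ h1
    rw [h2] at this
    exact lt_irrefl _ this

/-- The edge from a vertex to its parent. -/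
def edge (v : Vtx n p s) : Sym2 (Vtx n p s) := s(par v, v)

theorem edge_injOn : Set.InjOn (edge : Vtx n p s → _) {v | v ≠ .inl ()} := by
  intro a ha b hb hab
  rcases Sym2.eq_iff.1 hab with ⟨_, h⟩ | ⟨h1, h2⟩
  · exact h
  · have h3 := depth_par_lt a ha
    have h4 := depth_par_lt b hb
    rw [h1] at h3
    rw [← h2] at h4
    exact absurd h3 (not_lt.2 h4.le)

theorem Cut.ne_center {γ : CutData n p s} {v : Vtx n p s} (h : Cut γ v) : v ≠ .inl () := by
  rintro rfl
  exact h

/-- The set of edges cut by `γ`. -/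
noncomputable def cutEdges (γ : CutData n p s) : Finset (Sym2 (Vtx n p s)) :=
  (univ.filter (Cut γ)).image edge

theorem edge_mem_cutEdges {γ : CutData n p s} {v : Vtx n p s} (hv : v ≠ .inl ()) :
    edge v ∈ cutEdges γ ↔ Cut γ v := by
  simp only [cutEdges, mem_image, mem_filter, mem_univ, true_and]
  constructor
  · rintro ⟨w, hw, h⟩
    rwa [← edge_injOn hw.ne_center hv h]
  · exact fun h => ⟨v, h, rfl⟩

theorem mem_edgeFinset_iff (e : Sym2 (Vtx n p s)) :
    e ∈ (TpsGraph n p s).edgeFinset ↔ ∃ v, v ≠ .inl () ∧ edge v = e := by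
  rw [SimpleGraph.mem_edgeFinset]
  induction e using Sym2.ind with
  | _ a b =>
    rw [SimpleGraph.mem_edgeSet, adj_iff]
    constructor
    · rintro (⟨h, rfl⟩ | ⟨h, rfl⟩)
      · exact ⟨b, h, rfl⟩
      · exact ⟨a, h, Sym2.eq_swap⟩
    · rintro ⟨v, hv, h⟩
      rcases Sym2.eq_iff.1 h with ⟨rfl, rfl⟩ | ⟨rfl, rfl⟩
      · exact Or.inl ⟨hv, rfl⟩
      · exact Or.inr ⟨hv, rfl⟩

theorem cutEdges_injective : Function.Injective (cutEdges : CutData n p s → _) := by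
  intro γ δ h
  have key : ∀ v : Vtx n p s, v ≠ .inl () → (Cut γ v ↔ Cut δ v) := fun v hv => by
    rw [← edge_mem_cutEdges hv, ← edge_mem_cutEdges hv, h]
  funext i
  refine Prod.ext ?_ (Prod.ext ?_ ?_)
  · exact Bool.eq_iff_iff.2 (key (.inr (.inl i)) (by simp))
  · funext j
    ext l
    exact key (.inr (.inr (.inl ⟨i, j, l⟩))) (by simp)
  · funext j
    ext l
    exact key (.inr (.inr (.inr ⟨i, j, l⟩))) (by simp)

theorem exists_cutEdges_eq {A : Finset (Sym2 (Vtx n p s))}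
    (hA : A ⊆ (TpsGraph n p s).edgeFinset) : ∃ γ : CutData n p s, cutEdges γ = A := by
  let γ : CutData n p s := fun i => (decide (edge (.inr (.inl i)) ∈ A),
    fun j => univ.filter fun l => edge (.inr (.inr (.inl ⟨i, j, l⟩))) ∈ A,
    fun j => univ.filter fun l => edge (.inr (.inr (.inr ⟨i, j, l⟩))) ∈ A)
  have key : ∀ v, v ≠ .inl () → (Cut γ v ↔ edge v ∈ A) := by
    rintro (_ | i | ⟨i, j, l⟩ | ⟨i, j, l⟩) hv
    · exact absurd rfl hv
    · simp [γ, Cut]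
    · simp [γ, Cut]
    · simp [γ, Cut]
  refine ⟨γ, ?_⟩
  ext e
  constructor
  · simp only [cutEdges, mem_image, mem_filter, mem_univ, true_and]
    rintro ⟨v, hv, rfl⟩
    exact (key v hv.ne_center).1 hv
  · intro he
    obtain ⟨v, hv, rfl⟩ := (mem_edgeFinset_iff e).1 (hA he)
    exact (edge_mem_cutEdges hv).2 ((key v hv).2 he)

theorem powerset_edgeFinset_eq : (TpsGraph n p s).edgeFinset.powerset =
    (univ : Finset (CutData n p s)).map ⟨cutEdges, cutEdges_injective⟩ := by
  ext A
  simp only [mem_powerset, mem_map, mem_univ, true_and, Function.Embedding.coeFn_mk]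
  constructor
  · exact exists_cutEdges_eq
  · rintro ⟨γ, rfl⟩ e he
    obtain ⟨v, hv, rfl⟩ := mem_image.1 he
    exact (mem_edgeFinset_iff _).2 ⟨v, (mem_filter.1 hv).2.ne_center, rfl⟩

theorem deleteEdges_adj_iff (γ : CutData n p s) (u v : Vtx n p s) :
    ((TpsGraph n p s).deleteEdges (cutEdges γ : Set (Sym2 (Vtx n p s)))).Adj u v ↔
      (¬ (v = .inl () ∨ Cut γ v) ∧ par v = u) ∨ (¬ (u = .inl () ∨ Cut γ u) ∧ par u = v) := by
  rw [SimpleGraph.deleteEdges_adj, adj_iff, mem_coe]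
  have h1 : par v = u → v ≠ .inl () → (s(u, v) ∈ cutEdges γ ↔ Cut γ v) := by
    rintro rfl hv
    exact edge_mem_cutEdges hv
  have h2 : par u = v → u ≠ .inl () → (s(u, v) ∈ cutEdges γ ↔ Cut γ u) := by
    rintro rfl hv
    rw [Sym2.eq_swap]
    exact edge_mem_cutEdges hv
  tauto

theorem top_of_isTop (γ : CutData n p s) (v : Vtx n p s) (h : v = .inl () ∨ Cut γ v) :
    top γ v = v := by
  rcases v with _ | i | ⟨i, j, l⟩ | ⟨i, j, l⟩
  · rfl
  all_goals simp only [reduceCtorEq, false_or, Cut] at h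
  all_goals simp [top, rootTop, branchTop, h]

theorem top_par (γ : CutData n p s) (v : Vtx n p s) (h : ¬ (v = .inl () ∨ Cut γ v)) :
    top γ v = top γ (par v) := by
  rcases v with _ | i | ⟨i, j, l⟩ | ⟨i, j, l⟩
  · simp at h
  · simp only [reduceCtorEq, false_or, Cut] at h
    simp [top, rootTop, par, h]
  · simp only [reduceCtorEq, false_or, Cut] at h
    fin_cases l
    · simp_all [top, par, branchTop]
    · simp_all [top, par, branchTop]
    · simp_all [top, par, branchTop]
  · simp only [reduceCtorEq, false_or, Cut] at h
    fin_cases l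
    · simp_all [top, par, branchTop]
    · simp_all [top, par, branchTop]
    · simp_all [top, par, branchTop]

theorem sum_elim_of_forall_ne {β : Type*} [DecidableEq β] (st : Bool) (B : Finset (Fin 3)) (y r : β)
    (f : Fin 3 → β) (hf : ∀ l, f l ≠ r) :
    (∑ l, if (branchTop st B l).elim y f = r then 1 else 0) =
      if y = r then branchRest st B else 0 := by
  have h : ∀ l, ((branchTop st B l).elim y f = r ↔ branchTop st B l = none ∧ y = r) := by
    intro l
    cases branchTop st B l <;> simp [hf]
  simp only [h, ite_and, branchRest]
  split_ifs <;> simp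

theorem sum_elim_of_ne {β : Type*} [DecidableEq β] (st : Bool) (B : Finset (Fin 3)) (y : β)
    (l : Fin 3)
    (f : Fin 3 → β) (hf : Function.Injective f) (hy : y ≠ f l) :
    (∑ l', if (branchTop st B l').elim y f = f l then 1 else 0) =
      ∑ l', if branchTop st B l' = some l then 1 else 0 := by
  have h : ∀ l', ((branchTop st B l').elim y f = f l ↔ branchTop st B l' = some l) := by
    intro l'
    cases branchTop st B l' <;> simp [hf.eq_iff, hy]
  simp [h]

theorem sum_vtx {M : Type*} [AddCommMonoid M] (f : Vtx n p s → M) :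
    ∑ v, f v = f (.inl ()) + ∑ i, (f (.inr (.inl i)) +
      ((∑ j, ∑ l, f (.inr (.inr (.inl ⟨i, j, l⟩)))) +
        ∑ j, ∑ l, f (.inr (.inr (.inr ⟨i, j, l⟩))))) := by
  simp only [Fintype.sum_sum_type, Fintype.sum_sigma, Fintype.sum_prod_type,
    Finset.univ_unique, Finset.sum_singleton, Finset.sum_add_distrib]

theorem sum_top_eq (γ : CutData n p s) (r : Vtx n p s) :
    (∑ v, if top γ v = r then 1 else 0) =
      (if (.inl () : Vtx n p s) = r then 1 else 0) + ∑ i, ((if rootTop γ i = r then 1 else 0) +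
        ((∑ j, ∑ l, if (branchTop false ((γ i).2.1 j) l).elim (rootTop γ i)
          (fun l' => .inr (.inr (.inl ⟨i, j, l'⟩))) = r then 1 else 0) +
        ∑ j, ∑ l, if (branchTop true ((γ i).2.2 j) l).elim (rootTop γ i)
          (fun l' => .inr (.inr (.inr ⟨i, j, l'⟩))) = r then 1 else 0)) :=
  sum_vtx _

theorem sum_top_center (γ : CutData n p s) :
    (∑ v, if top γ v = .inl () then 1 else 0) = centerSize γ := by
  rw [sum_top_eq, centerSize, if_pos rfl]
  congr 1
  refine Finset.sum_congr rfl fun i _ => ?_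
  simp only [sum_elim_of_forall_ne, ne_eq, reduceCtorEq, not_false_eq_true, implies_true]
  by_cases h : (γ i).1 <;> simp [rootTop, h, rootRest]

theorem sum_top_root (γ : CutData n p s) (i : Fin n) (hi : (γ i).1 = true) :
    (∑ v, if top γ v = .inr (.inl i) then 1 else 0) = 1 + rootRest (γ i) := by
  rw [sum_top_eq, if_neg (by simp), zero_add, Finset.sum_eq_single i]
  · simp only [sum_elim_of_forall_ne, ne_eq, Sum.inr.injEq, reduceCtorEq, not_false_eq_true,
      implies_true]
    simp [rootTop, hi, rootRest]
  · intro i' _ hne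
    simp only [sum_elim_of_forall_ne, ne_eq, Sum.inr.injEq, reduceCtorEq, not_false_eq_true,
      implies_true]
    have : rootTop γ i' ≠ .inr (.inl i) := by
      rw [rootTop]
      split_ifs <;> simp [hne]
    simp [this]
  · simp

theorem rootTop_ne_inr_inr (γ : CutData n p s) (i : Fin n)
    (x : (Σ i : Fin n, Fin (p i) × Fin 3) ⊕ (Σ i : Fin n, Fin (s i) × Fin 3)) :
    rootTop γ i ≠ .inr (.inr x) := by
  rw [rootTop]
  split_ifs <;> simp

theorem sum_top_path (γ : CutData n p s) (i : Fin n) (j : Fin (p i)) (l : Fin 3) :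
    (∑ v, if top γ v = .inr (.inr (.inl ⟨i, j, l⟩)) then 1 else 0) =
      ∑ l', if branchTop false ((γ i).2.1 j) l' = some l then 1 else 0 := by
  rw [sum_top_eq, if_neg (by simp), zero_add, Finset.sum_eq_single i]
  · simp only [sum_elim_of_forall_ne true, ne_eq, Sum.inr.injEq, reduceCtorEq,
      not_false_eq_true, implies_true, rootTop_ne_inr_inr, if_false]
    rw [Finset.sum_eq_single j]
    · rw [sum_elim_of_ne false _ _ l (fun l' => (.inr (.inr (.inl ⟨i, j, l'⟩)) : Vtx n p s))
        (fun a b h => by simpa using h) (rootTop_ne_inr_inr γ i _)]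
      simp
    · intro j' _ hne
      rw [sum_elim_of_forall_ne _ _ _ _ _ (fun _ => by simp [hne]),
        if_neg (rootTop_ne_inr_inr γ i _)]
    · simp
  · intro i' _ hne
    simp only [sum_elim_of_forall_ne, ne_eq, Sum.inr.injEq, Sum.inl.injEq, reduceCtorEq,
      Sigma.mk.injEq, hne, false_and, not_false_eq_true, implies_true, rootTop_ne_inr_inr,
      if_false]
    simp
  · simp

theorem sum_top_star (γ : CutData n p s) (i : Fin n) (j : Fin (s i)) (l : Fin 3) :
    (∑ v, if top γ v = .inr (.inr (.inr ⟨i, j, l⟩)) then 1 else 0) =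
      ∑ l', if branchTop true ((γ i).2.2 j) l' = some l then 1 else 0 := by
  rw [sum_top_eq, if_neg (by simp), zero_add, Finset.sum_eq_single i]
  · simp only [sum_elim_of_forall_ne false, ne_eq, Sum.inr.injEq, reduceCtorEq,
      not_false_eq_true, implies_true, rootTop_ne_inr_inr, if_false]
    rw [Finset.sum_eq_single j]
    · rw [sum_elim_of_ne true _ _ l (fun l' => (.inr (.inr (.inr ⟨i, j, l'⟩)) : Vtx n p s))
        (fun a b h => by simpa using h) (rootTop_ne_inr_inr γ i _)]
      simp
    · intro j' _ hne
      rw [sum_elim_of_forall_ne _ _ _ _ _ (fun _ => by simp [hne]),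
        if_neg (rootTop_ne_inr_inr γ i _)]
    · simp
  · intro i' _ hne
    simp only [sum_elim_of_forall_ne, ne_eq, Sum.inr.injEq, reduceCtorEq,
      Sigma.mk.injEq, hne, false_and, not_false_eq_true, implies_true, rootTop_ne_inr_inr,
      if_false]
    simp
  · simp

theorem componentSizes_deleteEdges (γ : CutData n p s) :
    componentSizes ((TpsGraph n p s).deleteEdges (cutEdges γ : Set (Sym2 (Vtx n p s)))) =
      centerSize γ ::ₘ otherParts γ := by
  rw [componentSizes_eq_of_parent _ par (top γ) (fun v => v = .inl () ∨ Cut γ v) depth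
    (fun v hv => depth_par_lt v fun h => hv (Or.inl h)) (deleteEdges_adj_iff γ)
    (top_of_isTop γ) (top_par γ)]
  rw [sum_vtx, if_pos (Or.inl rfl), sum_top_center, ← Multiset.singleton_add, otherParts]
  congr 1
  refine Finset.sum_congr rfl fun i _ => ?_
  rw [rootParts]
  congr 1
  · by_cases h : (γ i).1 = true
    · simp only [Cut, reduceCtorEq, false_or, h, if_true, sum_top_root γ i h]
    · simp [Cut, h]
  congr 1
  · refine Finset.sum_congr rfl fun j _ => Finset.sum_congr rfl fun l _ => ?_
    by_cases h : l ∈ (γ i).2.1 j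
    · simp only [Cut, reduceCtorEq, false_or, h, if_true, sum_top_path]
    · simp [Cut, h]
  · refine Finset.sum_congr rfl fun j _ => Finset.sum_congr rfl fun l _ => ?_
    by_cases h : l ∈ (γ i).2.2 j
    · simp only [Cut, reduceCtorEq, false_or, h, if_true, sum_top_star]
    · simp [Cut, h]

theorem card_cutEdges (γ : CutData n p s) :
    (cutEdges γ).card = Multiset.card (otherParts γ) := by
  have hb : ∀ (st : Bool) (B : Finset (Fin 3)), Multiset.card (branchParts st B) =
      ∑ l, if l ∈ B then 1 else 0 := by
    intro st B
    rw [branchParts, Multiset.card_sum]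
    refine Finset.sum_congr rfl fun l _ => ?_
    split_ifs <;> simp
  rw [cutEdges, Finset.card_image_of_injOn, Finset.card_filter, otherParts, Multiset.card_sum]
  · rw [sum_vtx, if_neg (by simp [Cut]), zero_add]
    refine Finset.sum_congr rfl fun i _ => ?_
    simp only [rootParts, Multiset.card_add, Multiset.card_sum, hb, Cut]
    congr 1
    · by_cases h : (γ i).1 = true <;> simp [h]
    · congr 1
      · refine Finset.sum_congr rfl fun j _ => Finset.sum_congr rfl fun l _ => ?_
        by_cases h : l ∈ (γ i).2.1 j <;> simp only [h, if_true, if_false]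
      · refine Finset.sum_congr rfl fun j _ => Finset.sum_congr rfl fun l _ => ?_
        by_cases h : l ∈ (γ i).2.2 j <;> simp only [h, if_true, if_false]
  · exact edge_injOn.mono fun v hv => (mem_filter.1 hv).2.ne_center

theorem UkPoly_TpsGraph (k : ℕ) : UkPoly (TpsGraph n p s) k =
    ((univ : Finset (CutData n p s)).val.map fun γ => centerSize γ ::ₘ otherParts γ).filter
      fun m => Multiset.card m ≤ k + 1 := by
  rw [UkPoly, powerset_edgeFinset_eq, Finset.filter_map, Finset.map_val, Multiset.filter_map,
    Finset.filter_val]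
  simp only [Multiset.bind_def, Multiset.pure_def, Multiset.bind_singleton, Multiset.map_map]
  simp only [Function.comp_def, Function.Embedding.coeFn_mk, componentSizes_deleteEdges,
    card_cutEdges, Multiset.card_cons, Nat.add_le_add_iff_right]

end Vtx

open Polynomial in
/-- `h` is given by a polynomial whose coefficient of degree `d` lies in `I ^ (d + m)`. -/
def IsFiltPoly {L : Type*} [CommRing L] (I : Ideal L) (m : ℕ) (h : ℕ → L) : Prop :=
  ∃ q : L[X], (∀ d, q.coeff d ∈ I ^ (d + m)) ∧ ∀ a : ℕ, h a = q.eval (a : L)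

/-- By Newton's identities, the power sums determine the product of the `1 + z i`. -/
theorem prod_one_add_eq_of_sum_pow_eq {A ι : Type*} [CommRing A] [Algebra ℚ A] [Fintype ι]
    (z z' : ι → A) (h : ∀ r, 1 ≤ r → ∑ i, z i ^ r = ∑ i, z' i ^ r) :
    ∏ i, (1 + z i) = ∏ i, (1 + z' i) := by
  have newton : ∀ (w : ι → A) (j : ℕ), (j : A) * MvPolynomial.aeval w (MvPolynomial.esymm ι ℚ j) =
      (-1) ^ (j + 1) * ∑ a ∈ antidiagonal j with a.1 < j,
        (-1) ^ a.1 * MvPolynomial.aeval w (MvPolynomial.esymm ι ℚ a.1) * ∑ i, w i ^ a.2 := by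
    intro w j
    have := congrArg (MvPolynomial.aeval w) (MvPolynomial.mul_esymm_eq_sum ι ℚ j)
    simpa [MvPolynomial.psum] using this
  have key : ∀ j, MvPolynomial.aeval z (MvPolynomial.esymm ι ℚ j) =
      MvPolynomial.aeval z' (MvPolynomial.esymm ι ℚ j) := by
    intro j
    induction j using Nat.strong_induction_on with
    | _ j ih =>
      rcases Nat.eq_zero_or_pos j with rfl | hj
      · simp
      have hu : IsUnit (j : A) := by
        have : IsUnit (algebraMap ℚ A j) := (IsUnit.mk0 (j : ℚ) (by positivity)).map _
        simpa using this
      refine hu.mul_left_cancel ?_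
      rw [newton, newton]
      congr 1
      refine Finset.sum_congr rfl fun a ha => ?_
      obtain ⟨ha1, ha2⟩ := mem_filter.1 ha
      rw [HasAntidiagonal.mem_antidiagonal] at ha1
      rw [ih _ ha2, h a.2 (by omega)]
  have expand : ∀ w : ι → A, ∏ i, (1 + w i) = ∑ j ∈ range (Fintype.card ι + 1),
      MvPolynomial.aeval w (MvPolynomial.esymm ι ℚ j) := by
    intro w
    rw [Finset.prod_one_add, Finset.sum_powerset]
    refine Finset.sum_congr rfl fun j _ => ?_
    simp [MvPolynomial.esymm]
  simp only [expand, key]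

namespace IsFiltPoly

variable {L : Type*} [CommRing L] {I : Ideal L} {m m' : ℕ} {h h' : ℕ → L}

theorem mul (hh : IsFiltPoly I m h) (hh' : IsFiltPoly I m' h') :
    IsFiltPoly I (m + m') fun a => h a * h' a := by
  obtain ⟨q, hq, hq'⟩ := hh
  obtain ⟨r, hr, hr'⟩ := hh'
  refine ⟨q * r, fun d => ?_, fun a => by simp only [hq', hr', Polynomial.eval_mul]⟩
  rw [Polynomial.coeff_mul]
  refine Ideal.sum_mem _ fun x hx => ?_
  have : d + (m + m') = (x.1 + m) + (x.2 + m') := by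
    rw [← HasAntidiagonal.mem_antidiagonal.1 hx]; ring
  rw [this, pow_add]
  exact Ideal.mul_mem_mul (hq _) (hr _)

theorem mono (hh : IsFiltPoly I m h) (hm : m' ≤ m) : IsFiltPoly I m' h := by
  obtain ⟨q, hq, hq'⟩ := hh
  exact ⟨q, fun d => Ideal.pow_le_pow_right (by omega) (hq d), hq'⟩

theorem pow (hh : IsFiltPoly I 1 h) (r : ℕ) : IsFiltPoly I 1 fun a => h a ^ (r + 1) := by
  induction r with
  | zero => simpa using hh
  | succ r ih =>
    have := (ih.mul hh).mono (m' := 1) (by omega)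
    simpa only [pow_succ] using this

theorem sum {ι : Type*} (s : Finset ι) (f : ι → ℕ → L) (hf : ∀ i ∈ s, IsFiltPoly I m (f i)) :
    IsFiltPoly I m fun a => ∑ i ∈ s, f i a := by
  choose! q hq hq' using hf
  refine ⟨∑ i ∈ s, q i, fun d => ?_, fun a => ?_⟩
  · rw [Polynomial.finsetSum_coeff]
    exact Ideal.sum_mem _ fun i hi => hq i hi d
  · rw [Polynomial.eval_finsetSum]
    exact Finset.sum_congr rfl fun i hi => hq' i hi a

theorem mul_choose [Algebra ℚ L] {c : L} {b : ℕ} (hc : c ∈ I ^ (b + m)) :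
    IsFiltPoly I m fun a => c * (a.choose b : L) := by
  refine ⟨Polynomial.C c * (Polynomial.C (b.factorial : ℚ)⁻¹ * descPochhammer ℚ b).map
    (algebraMap ℚ L), fun d => ?_, fun a => ?_⟩
  · rw [Polynomial.coeff_C_mul]
    by_cases hd : d ≤ b
    · exact Ideal.mul_mem_right _ _ (Ideal.pow_le_pow_right (by omega) hc)
    · rw [Polynomial.coeff_map, Polynomial.coeff_C_mul,
        Polynomial.coeff_eq_zero_of_natDegree_lt (p := descPochhammer ℚ b)
          (by rw [descPochhammer_natDegree]; omega)]
      simp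
  · rw [Polynomial.eval_mul, Polynomial.eval_C, Polynomial.eval_natCast_map, Polynomial.eval_mul,
      Polynomial.eval_C, descPochhammer_eval_eq_descFactorial,
      Nat.descFactorial_eq_factorial_mul_choose, Nat.cast_mul, inv_mul_cancel_left₀ (by positivity)]
    simp

theorem sum_eq {k n : ℕ} (hI : I ^ (k + 2) = ⊥) (hh : IsFiltPoly I 1 h) {p p' : Fin n → ℕ}
    (hp : PTErel k p p') : ∑ i, h (p i) = ∑ i, h (p' i) := by
  obtain ⟨q, hq, hq'⟩ := hh
  have hdeg : q.natDegree < k + 1 := by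
    rw [Nat.lt_succ_iff, Polynomial.natDegree_le_iff_coeff_eq_zero]
    intro d hd
    have := Ideal.pow_le_pow_right (show k + 2 ≤ d + 1 by omega) (hq d)
    rwa [hI, Ideal.mem_bot] at this
  simp only [hq', Polynomial.eval_eq_sum_range' hdeg]
  rw [Finset.sum_comm, Finset.sum_comm (s := univ)]
  refine Finset.sum_congr rfl fun d hd => ?_
  rw [← Finset.mul_sum, ← Finset.mul_sum]
  congr 1
  rcases Nat.eq_zero_or_pos d with rfl | hd0
  · simp
  · exact_mod_cast congrArg (Nat.cast : ℕ → L) (hp d hd0 (by rw [mem_range] at hd; omega))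

end IsFiltPoly

theorem one_add_pow_eq_sum_range {L : Type*} [CommRing L] {I : Ideal L} {N : ℕ} (hI : I ^ N = ⊥)
    {u : L} (hu : u ∈ I) (a : ℕ) :
    (1 + u) ^ a = ∑ b ∈ range N, u ^ b * (a.choose b : L) := by
  have hz : ∀ b, N ≤ b → u ^ b = 0 := fun b hb => by
    have := Ideal.pow_le_pow_right hb (Ideal.pow_mem_pow hu b)
    rwa [hI, Ideal.mem_bot] at this
  rw [add_comm, add_pow]
  simp only [one_pow, mul_one]
  rcases le_total (a + 1) N with h | h
  · refine Finset.sum_subset (range_subset_range.2 h) fun b _ hb => ?_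
    rw [Nat.choose_eq_zero_of_lt (by simpa using hb)]
    simp
  · refine (Finset.sum_subset (range_subset_range.2 h) fun b _ hb => ?_).symm
    rw [hz b (by simpa using hb), zero_mul]

/-- Let `Φ` raise the `I`-adic filtration, where `I ^ (k + 2) = 0`. The product of the
`f (p i) + Φ (f (p i))` for `f a = F (1 + u) ^ a` depends only on the first `k` power sums. -/
theorem prod_add_eq_of_PTErel {L : Type*} [CommRing L] [Algebra ℚ L] {I : Ideal L} {k n : ℕ}
    (hk : 0 < k) (hI : I ^ (k + 2) = ⊥) {u : L} (hu : u ∈ I) (F : Lˣ) (Φ : L →+ L)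
    (hΦ : ∀ d, ∀ y ∈ I ^ d, Φ y ∈ I ^ (d + 1)) {p p' : Fin n → ℕ} (hp : PTErel k p p') :
    ∏ i, (F * (1 + u) ^ p i + Φ (F * (1 + u) ^ p i)) =
      ∏ i, (F * (1 + u) ^ p' i + Φ (F * (1 + u) ^ p' i)) := by
  have hnil : IsNilpotent u := ⟨k + 2, by
    have := Ideal.pow_mem_pow hu (k + 2); rwa [hI, Ideal.mem_bot] at this⟩
  obtain ⟨w, hw⟩ := hnil.isUnit_one_add
  have hv : (↑w⁻¹ - 1 : L) ∈ I := by
    have : (↑w⁻¹ - 1 : L) = -(↑w⁻¹ * u) := by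
      have h1 : (↑w⁻¹ : L) * (1 + u) = 1 := by rw [← hw, Units.inv_mul]
      linear_combination h1
    rw [this]
    exact I.neg_mem (Ideal.mul_mem_left _ _ hu)
  set v : L := ↑w⁻¹ - 1 with hvdef
  set g : ℕ → L := fun a => ↑F⁻¹ * (1 + v) ^ a * Φ (F * (1 + u) ^ a) with hg
  have hgpoly : IsFiltPoly I 1 g := by
    have h1 : IsFiltPoly I 0 fun a => (1 + v) ^ a := by
      simp only [one_add_pow_eq_sum_range hI hv]
      exact IsFiltPoly.sum _ _ fun b _ => IsFiltPoly.mul_choose (Ideal.pow_mem_pow hv b)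
    have h2 : IsFiltPoly I 1 fun a => ↑F⁻¹ * Φ (F * (1 + u) ^ a) := by
      have : (fun a => ↑F⁻¹ * Φ (F * (1 + u) ^ a)) = fun a => ∑ b ∈ range (k + 2),
          (↑F⁻¹ * Φ (F * u ^ b)) * (a.choose b : L) := by
        funext a
        rw [one_add_pow_eq_sum_range hI hu, Finset.mul_sum, map_sum, Finset.mul_sum]
        refine Finset.sum_congr rfl fun b _ => ?_
        rw [← mul_assoc, mul_comm _ (Nat.cast _ : L), ← nsmul_eq_mul, map_nsmul, nsmul_eq_mul]
        ring
      rw [this]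
      exact IsFiltPoly.sum _ _ fun b _ => IsFiltPoly.mul_choose
        (Ideal.mul_mem_left _ _ (hΦ b _ (Ideal.mul_mem_left _ _ (Ideal.pow_mem_pow hu b))))
    have := h1.mul h2
    rw [zero_add] at this
    convert this using 2 with a
    simp only [hg]
    ring
  have hfact : ∀ a, (F * (1 + u) ^ a + Φ (F * (1 + u) ^ a) : L) = F * (1 + u) ^ a * (1 + g a) := by
    intro a
    have h1 : (1 + u) ^ a * (1 + v) ^ a = 1 := by
      rw [← mul_pow, ← hw, hvdef, add_sub_cancel, Units.mul_inv, one_pow]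
    have h2 : (F : L) * ↑F⁻¹ = 1 := Units.mul_inv F
    simp only [hg]
    linear_combination (-(Φ (F * (1 + u) ^ a)) * (1 + u) ^ a * (1 + v) ^ a) * h2 -
      (Φ (F * (1 + u) ^ a)) * h1
  simp only [hfact, Finset.prod_mul_distrib, Finset.prod_pow_eq_pow_sum]
  have hs : ∑ i, p i = ∑ i, p' i := by simpa using hp 1 le_rfl hk
  rw [hs]
  congr 1
  refine prod_one_add_eq_of_sum_pow_eq _ _ fun r hr => ?_
  obtain ⟨r, rfl⟩ := Nat.exists_eq_add_of_le' hr
  exact (hgpoly.pow r).sum_eq hI hp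

namespace LaurentPolynomial

variable {R : Type*} [CommRing R] (x : ℕ → R)

/-- The term `x_r T ^ c`, where `x_r` is the product of the `x m` over `m ∈ r`. -/
noncomputable def wt (c : ℕ) (r : Multiset ℕ) : R[T;T⁻¹] := C (r.map x).prod * T (c : ℤ)

theorem wt_mul (c c' : ℕ) (r r' : Multiset ℕ) :
    wt x c r * wt x c' r' = wt x (c + c') (r + r') := by
  rw [wt, wt, wt, Multiset.map_add, Multiset.prod_add, map_mul, Nat.cast_add, T_add]
  ring

theorem wt_zero : wt x 0 0 = 1 := by
  simp [wt]

theorem prod_wt {ι : Type*} (s : Finset ι) (c : ι → ℕ) (r : ι → Multiset ℕ) :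
    ∏ i ∈ s, wt x (c i) (r i) = wt x (∑ i ∈ s, c i) (∑ i ∈ s, r i) := by
  induction s using Finset.induction_on with
  | empty => simp [wt_zero]
  | insert a s ha ih => rw [prod_insert ha, sum_insert ha, sum_insert ha, ih, wt_mul]

theorem coeff_wt (c a : ℕ) (r : Multiset ℕ) :
    (wt x c r).coeff (a : ℤ) = if c = a then (r.map x).prod else 0 := by
  rw [wt, ← single_eq_C_mul_T, AddMonoidAlgebra.coeff_single, Finsupp.single_apply]
  simp only [Nat.cast_inj]

/-- The additive map replacing `T ^ m` by `x m`. -/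
noncomputable def detach : R[T;T⁻¹] →+ R[T;T⁻¹] :=
  AddMonoidAlgebra.liftNC (C : R →+* R[T;T⁻¹]).toAddMonoidHom fun m => C (x m.toAdd.toNat)

theorem detach_C_mul_T (a : R) (m : ℤ) : detach x (C a * T m) = C (a * x m.toNat) := by
  rw [← single_eq_C_mul_T, detach, AddMonoidAlgebra.liftNC_single, map_mul]
  rfl

theorem detach_wt (c : ℕ) (r : Multiset ℕ) : detach x (wt x c r) = wt x 0 ({c} + r) := by
  rw [wt, detach_C_mul_T, wt, Multiset.singleton_add, Multiset.map_cons, Multiset.prod_cons,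
    mul_comm]
  simp

theorem detach_mul_C (y : R[T;T⁻¹]) (a : R) : detach x (y * C a) = C a * detach x y := by
  induction y using LaurentPolynomial.induction_on' with
  | add f g hf hg => rw [add_mul, map_add, map_add, hf, hg, mul_add]
  | C_mul_T m b =>
    rw [show C b * T m * C a = C (a * b) * T m by rw [map_mul]; ring, detach_C_mul_T,
      detach_C_mul_T, ← map_mul, mul_assoc]

variable {x} {K : Ideal R}

theorem wt_mem (hx : ∀ m, x m ∈ K) (c : ℕ) {r : Multiset ℕ} (hr : r ≠ 0) : wt x c r ∈ K.map C := by
  refine Ideal.mul_mem_right _ _ (Ideal.mem_map_of_mem _ ?_)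
  obtain ⟨a, ha⟩ := Multiset.exists_mem_of_ne_zero hr
  rw [← Multiset.cons_erase ha, Multiset.map_cons, Multiset.prod_cons]
  exact Ideal.mul_mem_right _ _ (hx a)

theorem detach_mem (hx : ∀ m, x m ∈ K) (y : R[T;T⁻¹]) : detach x y ∈ K.map C := by
  induction y using LaurentPolynomial.induction_on' with
  | add f g hf hg => rw [map_add]; exact Ideal.add_mem _ hf hg
  | C_mul_T m b =>
    rw [detach_C_mul_T]
    exact Ideal.mem_map_of_mem _ (Ideal.mul_mem_left _ _ (hx _))

theorem detach_mem_pow (hx : ∀ m, x m ∈ K) (d : ℕ) (y : R[T;T⁻¹])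
    (hy : y ∈ K.map C ^ d) :
    detach x y ∈ K.map C ^ (d + 1) := by
  suffices ∀ b, detach x (b * y) ∈ K.map C ^ (d + 1) by simpa using this 1
  rw [← Ideal.map_pow] at hy
  induction hy using Submodule.span_induction with
  | mem y h =>
    obtain ⟨a, ha, rfl⟩ := h
    intro b
    rw [detach_mul_C, pow_succ, ← Ideal.map_pow]
    exact Ideal.mul_mem_mul (Ideal.mem_map_of_mem _ ha) (detach_mem hx b)
  | zero => simp
  | add y z _ _ ihy ihz =>
    intro b
    rw [mul_add, map_add]
    exact Ideal.add_mem _ (ihy b) (ihz b)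
  | smul a y _ ih =>
    intro b
    rw [smul_eq_mul, ← mul_assoc]
    exact ih _

end LaurentPolynomial

open LaurentPolynomial

/-- Rational polynomials in `x₀, x₁, …` truncated in degrees `≥ N`. -/
abbrev TruncRing (N : ℕ) : Type := MvPolynomial ℕ ℚ ⧸ (MvPolynomial.idealOfVars ℕ ℚ) ^ N

namespace TruncRing

/-- The class of the variable of index `m`. -/
noncomputable def var (N m : ℕ) : TruncRing N := Ideal.Quotient.mk _ (MvPolynomial.X m)

theorem prod_map_var (N : ℕ) (r : Multiset ℕ) : (r.map (var N)).prod =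
    Ideal.Quotient.mk _ (MvPolynomial.monomial (Multiset.toFinsupp r) 1) := by
  induction r using Multiset.induction_on with
  | empty => simp
  | cons a r ih =>
    rw [Multiset.map_cons, Multiset.prod_cons, ih, var, ← map_mul, MvPolynomial.X,
      MvPolynomial.monomial_mul, one_mul, ← Multiset.singleton_add, map_add,
      Multiset.toFinsupp_singleton]

/-- A sum of terms `x_r T ^ c` determines how often each term of degree `< N` occurs. -/
theorem card_eq_of_sum_wt_eq {N : ℕ} {ι ι' : Type} [Fintype ι] [Fintype ι']
    {c : ι → ℕ} {c' : ι' → ℕ} {r : ι → Multiset ℕ} {r' : ι' → Multiset ℕ}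
    (h : ∑ i, wt (var N) (c i) (r i) = ∑ i, wt (var N) (c' i) (r' i)) (a : ℕ) (m : Multiset ℕ)
    (hm : Multiset.card m < N) :
    #{i | c i = a ∧ r i = m} = #{i | c' i = a ∧ r' i = m} := by
  have hc : ∀ {κ : Type} [Fintype κ] (c : κ → ℕ) (r : κ → Multiset ℕ),
      (∑ i, wt (var N) (c i) (r i)).coeff (a : ℤ) = Ideal.Quotient.mk _
        (∑ i, if c i = a then MvPolynomial.monomial (Multiset.toFinsupp (r i)) 1 else 0) := by
    intro κ _ c r
    rw [AddMonoidAlgebra.coeff_sum, Finsupp.finsetSum_apply, map_sum]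
    refine Finset.sum_congr rfl fun i _ => ?_
    rw [coeff_wt, prod_map_var]
    split_ifs <;> simp
  have hd : ∀ {κ : Type} [Fintype κ] (c : κ → ℕ) (r : κ → Multiset ℕ),
      MvPolynomial.coeff (Multiset.toFinsupp m)
        (∑ i, if c i = a then MvPolynomial.monomial (Multiset.toFinsupp (r i)) (1 : ℚ) else 0) =
        #{i | c i = a ∧ r i = m} := by
    intro κ _ c r
    rw [MvPolynomial.coeff_sum, Finset.card_filter, Nat.cast_sum]
    refine Finset.sum_congr rfl fun i _ => ?_
    by_cases h1 : c i = a <;> by_cases h2 : r i = m <;>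
      simp [h1, h2, MvPolynomial.coeff_monomial]
  have := congrArg (fun y => y.coeff (a : ℤ)) h
  simp only [hc] at this
  rw [Ideal.Quotient.eq, MvPolynomial.mem_pow_idealOfVars_iff'] at this
  have := this (Multiset.toFinsupp m) ((Multiset.toFinsupp_sum_eq m).trans_lt hm)
  rw [MvPolynomial.coeff_sub, hd, hd, sub_eq_zero] at this
  exact_mod_cast this

end TruncRing

section GeneratingFunction

variable {R : Type*} [CommRing R] (x : ℕ → R)

/-- The generating function of the ways to cut one hanging copy. -/
noncomputable def branchGen (star : Bool) : R[T;T⁻¹] :=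
  ∑ B, wt x (branchRest star B) (branchParts star B)

/-- The generating function of the ways to cut the copies hanging at one root. -/
noncomputable def rootGen (a b : ℕ) : R[T;T⁻¹] :=
  T 1 * (branchGen x false ^ a * branchGen x true ^ b)

theorem branchGen_pow (star : Bool) (a : ℕ) : branchGen x star ^ a =
    ∑ φ : Fin a → Finset (Fin 3),
      wt x (∑ j, branchRest star (φ j)) (∑ j, branchParts star (φ j)) := by
  rw [← Fin.prod_const, branchGen, Finset.prod_univ_sum, Fintype.piFinset_univ]
  exact Finset.sum_congr rfl fun φ _ => prod_wt x _ _ _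

theorem rootGen_eq_sum (a b : ℕ) : rootGen x a b =
    ∑ φ : (Fin a → Finset (Fin 3)) × (Fin b → Finset (Fin 3)),
      wt x (1 + rootRest (false, φ)) (rootParts (false, φ)) := by
  rw [rootGen, branchGen_pow, branchGen_pow, Finset.sum_mul_sum, Fintype.sum_prod_type,
    Finset.mul_sum]
  refine Finset.sum_congr rfl fun φ _ => ?_
  rw [Finset.mul_sum]
  refine Finset.sum_congr rfl fun ψ _ => ?_
  have h1 : (T 1 : R[T;T⁻¹]) = wt x 1 0 := by simp [wt]
  rw [wt_mul, h1, wt_mul, zero_add]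
  rfl

theorem sum_rootCut (a b : ℕ) : ∑ c : RootCut a b, wt x (if c.1 then 0 else 1 + rootRest c)
      ((if c.1 then {1 + rootRest c} else 0) + rootParts c) =
    rootGen x a b + detach x (rootGen x a b) := by
  rw [Fintype.sum_prod_type, Fintype.sum_bool, add_comm]
  congr 1
  · rw [rootGen_eq_sum]
    simp
  · rw [rootGen_eq_sum, map_sum]
    simp only [detach_wt]
    rfl

theorem sum_cutData {n : ℕ} (p s : Fin n → ℕ) :
    ∑ γ : CutData n p s, wt x (centerSize γ) (otherParts γ) =
      T 1 * ∏ i, (rootGen x (p i) (s i) + detach x (rootGen x (p i) (s i))) := by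
  simp only [← sum_rootCut]
  rw [Finset.prod_univ_sum, Fintype.piFinset_univ, Finset.mul_sum]
  refine Finset.sum_congr rfl fun γ _ => ?_
  have h1 : (T 1 : R[T;T⁻¹]) = wt x 1 0 := by simp [wt]
  rw [prod_wt, h1, wt_mul, zero_add]
  rfl

theorem branchParts_eq_zero_iff (star : Bool) (B : Finset (Fin 3)) :
    branchParts star B = 0 ↔ B = ∅ := by
  revert B star
  decide

theorem branchGen_sub_mem {x : ℕ → R} {K : Ideal R} (hx : ∀ m, x m ∈ K) (star : Bool) :
    branchGen x star - T 3 ∈ K.map C := by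
  have h3 : wt x (branchRest star ∅) (branchParts star ∅) = T 3 := by
    rw [(branchParts_eq_zero_iff star ∅).2 rfl,
      show branchRest star ∅ = 3 by revert star; decide]
    simp [wt]
  rw [branchGen, ← Finset.add_sum_erase _ _ (mem_univ ∅), h3, add_sub_cancel_left]
  exact Ideal.sum_mem _ fun B hB => wt_mem hx _ fun h =>
    (Finset.mem_erase.1 hB).1 ((branchParts_eq_zero_iff star B).1 h)

theorem sum_cutData_eq_of_PTErel [Algebra ℚ R] {x : ℕ → R} {K : Ideal R} (hx : ∀ m, x m ∈ K)
    {k n α : ℕ} (hk : 0 < k) (hK : K ^ (k + 2) = ⊥) {p p' : Fin n → ℕ} (hα : ∀ i, p i ≤ α)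
    (hα' : ∀ i, p' i ≤ α) (hp : PTErel k p p') :
    ∑ γ : CutData n p fun i => α - p i, wt x (centerSize γ) (otherParts γ) =
      ∑ γ : CutData n p' fun i => α - p' i, wt x (centerSize γ) (otherParts γ) := by
  have hI : K.map (C : R →+* R[T;T⁻¹]) ^ (k + 2) = ⊥ := by
    rw [← Ideal.map_pow, hK, Ideal.map_bot]
  have hS : IsUnit (branchGen x true) := by
    have hn : IsNilpotent (branchGen x true - T 3) := ⟨k + 2, by
      have := Ideal.pow_mem_pow (branchGen_sub_mem hx true) (k + 2)
      rwa [hI, Ideal.mem_bot] at this⟩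
    have := hn.isUnit_add_left_of_commute (isUnit_T 3) (Commute.all _ _)
    rwa [add_sub_cancel] at this
  obtain ⟨S, hS⟩ := hS
  obtain ⟨t, ht⟩ := isUnit_T (R := R) 1
  set u : R[T;T⁻¹] := ↑S⁻¹ * branchGen x false - 1 with hu
  have huI : u ∈ K.map C := by
    have : u = (↑S⁻¹ : R[T;T⁻¹]) * ((branchGen x false - T 3) - (branchGen x true - T 3)) := by
      rw [← hS, sub_sub_sub_cancel_right, mul_sub, Units.inv_mul]
    rw [this]
    exact Ideal.mul_mem_left _ _
      (Ideal.sub_mem _ (branchGen_sub_mem hx false) (branchGen_sub_mem hx true))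
  have hroot : ∀ a ≤ α, rootGen x a (α - a) = ↑(t * S ^ α) * (1 + u) ^ a := by
    intro a ha
    obtain ⟨b, rfl⟩ := Nat.exists_eq_add_of_le ha
    have h1 : (S : R[T;T⁻¹]) * ↑S⁻¹ = 1 := Units.mul_inv S
    rw [rootGen, hu, add_sub_cancel, Nat.add_sub_cancel_left, ← hS, Units.val_mul, ht,
      Units.val_pow_eq_pow_val, mul_pow, pow_add]
    have h2 : (S : R[T;T⁻¹]) ^ a * ↑S⁻¹ ^ a = 1 := by rw [← mul_pow, h1, one_pow]
    linear_combination (-(T 1 * S ^ b * branchGen x false ^ a)) * h2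
  rw [sum_cutData, sum_cutData]
  simp only [hroot _ (hα _), hroot _ (hα' _)]
  rw [prod_add_eq_of_PTErel hk hI huI (t * S ^ α) (detach x) (detach_mem_pow hx) hp]

end GeneratingFunction

theorem UkPoly_eq_of_PTErel {k n α : ℕ} (hk : 0 < k) {p p' : Fin n → ℕ} (hα : ∀ i, p i ≤ α)
    (hα' : ∀ i, p' i ≤ α) (hp : PTErel k p p') :
    UkPoly (Ttree α p) (k + 1) = UkPoly (Ttree α p') (k + 1) := by
  have hsum := sum_cutData_eq_of_PTErel (x := TruncRing.var (k + 2))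
    (K := (MvPolynomial.idealOfVars ℕ ℚ).map (Ideal.Quotient.mk _))
    (fun m => Ideal.mem_map_of_mem _ (Ideal.subset_span ⟨m, rfl⟩)) hk
    (by rw [← Ideal.map_pow, Ideal.map_quotient_self]) hα hα' hp
  have hcard := TruncRing.card_eq_of_sum_wt_eq hsum
  have key : ∀ q : Fin n → ℕ, UkPoly (Ttree α q) (k + 1) =
      ((((univ : Finset (CutData n q fun i => α - q i)).val.map fun γ =>
        (centerSize γ, otherParts γ)).filter fun m => Multiset.card m.2 < k + 2).map
          fun m => m.1 ::ₘ m.2) := by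
    intro q
    rw [Ttree, Vtx.UkPoly_TpsGraph, Multiset.filter_map, Multiset.filter_map, Multiset.map_map]
    simp only [Function.comp_def, Multiset.card_cons, Nat.lt_succ_iff, Nat.add_le_add_iff_right]
  rw [key, key]
  congr 1
  ext ⟨a, m⟩
  rw [Multiset.count_filter, Multiset.count_filter]
  split_ifs with hm
  · rw [Multiset.count_map, Multiset.count_map]
    have := hcard a m hm
    simp only [Finset.card, Finset.filter_val] at this
    simpa only [Prod.mk.injEq, eq_comm] using this
  · rfl

/-- Equal binomial moments of orders `≤ M` give equal power sums of orders `≤ M`. -/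
theorem sum_pow_eq_of_sum_descFactorial_eq {ι : Type*} [Fintype ι] {M : ℕ} {y y' : ι → ℕ}
    (h : ∀ j ≤ M, ∑ i, (y i).descFactorial j = ∑ i, (y' i).descFactorial j) {ℓ : ℕ} (hℓ : ℓ ≤ M) :
    ∑ i, y i ^ ℓ = ∑ i, y' i ^ ℓ := by
  have step : ∀ a ℓ j : ℕ, a ^ (ℓ + 1) * a.descFactorial j =
      a ^ ℓ * a.descFactorial (j + 1) + j * (a ^ ℓ * a.descFactorial j) := by
    intro a ℓ j
    rw [Nat.descFactorial_succ]
    rcases lt_or_ge a j with ha | ha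
    · simp [Nat.descFactorial_eq_zero_iff_lt.2 ha]
    · obtain ⟨b, rfl⟩ := Nat.exists_eq_add_of_le ha
      rw [Nat.add_sub_cancel_left]
      ring
  have key : ∀ ℓ j, ℓ + j ≤ M → ∑ i, y i ^ ℓ * (y i).descFactorial j =
      ∑ i, y' i ^ ℓ * (y' i).descFactorial j := by
    intro ℓ
    induction ℓ with
    | zero => intro j hj; simpa using h j (by omega)
    | succ ℓ ih =>
      intro j hj
      simp only [step, Finset.sum_add_distrib, ← Finset.mul_sum]
      rw [ih (j + 1) (by omega), ih j (by omega)]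
  simpa using key ℓ 0 hℓ

theorem sum_eval_eq_of_sum_pow_eq {ι : Type*} [Fintype ι] {M : ℕ} {y y' : ι → ℕ}
    (h : ∀ j ≤ M, ∑ i, y i ^ j = ∑ i, y' i ^ j) {q : Polynomial ℤ} (hq : q.natDegree ≤ M) :
    ∑ i, q.eval (y i : ℤ) = ∑ i, q.eval (y' i : ℤ) := by
  simp only [Polynomial.eval_eq_sum_range]
  rw [Finset.sum_comm, Finset.sum_comm (s := univ)]
  refine Finset.sum_congr rfl fun d hd => ?_
  rw [← Finset.mul_sum, ← Finset.mul_sum]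
  rw [mem_range] at hd
  congr 1
  exact_mod_cast h d (by omega)

/-- The power sums of orders `≤ k` of a sequence with entries in `[0, α]` are determined by its sum
`σ` and the sums of the binomials `(σ - p i).choose j` with `j ≤ k` and `j ≤ α`. -/
theorem PTErel_of_sum_choose_eq {k n α : ℕ} {p p' : Fin n → ℕ} (hα : ∀ i, p i ≤ α)
    (hα' : ∀ i, p' i ≤ α) (hσ : ∑ i, p i = ∑ i, p' i)
    (h : ∀ j, 2 ≤ j → j ≤ k → j ≤ α →
      ∑ i, (∑ m, p m - p i).choose j = ∑ i, (∑ m, p' m - p' i).choose j) :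
    PTErel k p p' := by
  have hle : ∀ q : Fin n → ℕ, ∀ i, q i ≤ ∑ m, q m := fun q i =>
    Finset.single_le_sum (fun _ _ => Nat.zero_le _) (mem_univ i)
  have hy : ∀ j ≤ min k α, ∑ i, (∑ m, p m - p i).descFactorial j =
      ∑ i, (∑ m, p' m - p' i).descFactorial j := by
    intro j hj
    rw [le_min_iff] at hj
    rcases Nat.lt_or_ge j 2 with hj2 | hj2
    · interval_cases j
      · simp
      · simp only [Nat.descFactorial_one]
        zify
        simp only [Nat.cast_sub (hle p _), Nat.cast_sub (hle p' _)]
        rw [Finset.sum_sub_distrib, Finset.sum_sub_distrib, hσ]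
        congr 1
        exact_mod_cast hσ
    · simp only [Nat.descFactorial_eq_factorial_mul_choose, ← Finset.mul_sum, h j hj2 hj.1 hj.2]
  have hd : ∀ j ≤ k, ∑ i, (p i).descFactorial j = ∑ i, (p' i).descFactorial j := by
    intro j hj
    rcases le_or_gt j α with hjα | hjα
    · have hq : ((descPochhammer ℤ j).comp
          (Polynomial.C ((∑ m, p m : ℕ) : ℤ) - Polynomial.X)).natDegree ≤ min k α := by
        refine Polynomial.natDegree_comp_le.trans ?_
        rw [descPochhammer_natDegree]
        have : (Polynomial.C ((∑ m, p m : ℕ) : ℤ) - Polynomial.X).natDegree ≤ 1 :=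
          Polynomial.natDegree_sub_le_of_le ((Polynomial.natDegree_C _).le.trans zero_le_one)
            Polynomial.natDegree_X_le
        exact (Nat.mul_le_mul_left j this).trans (by omega)
      have := sum_eval_eq_of_sum_pow_eq (fun j hj => sum_pow_eq_of_sum_descFactorial_eq hy hj) hq
      have hev : ∀ q : Fin n → ℕ, ∑ m, p m = ∑ m, q m → ∀ i,
          ((descPochhammer ℤ j).comp (Polynomial.C ((∑ m, p m : ℕ) : ℤ) - Polynomial.X)).eval
            ((∑ m, q m - q i : ℕ) : ℤ) = ((q i).descFactorial j : ℕ) := by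
        intro q hq i
        rw [Polynomial.eval_comp, hq, Nat.cast_sub (hle q i),
          ← descPochhammer_eval_eq_descFactorial, Polynomial.eval_sub, Polynomial.eval_C, Polynomial.eval_X, sub_sub_cancel]
      simp only [hev p rfl, hev p' hσ] at this
      exact_mod_cast this
    · simp [Nat.descFactorial_eq_zero_iff_lt.2 ((hα _).trans_lt hjα),
        Nat.descFactorial_eq_zero_iff_lt.2 ((hα' _).trans_lt hjα)]
  exact fun ℓ _ hℓ => sum_pow_eq_of_sum_descFactorial_eq hd hℓ

theorem card_filter_eq_of_UkPoly_eq {k n : ℕ} {p s p' s' : Fin n → ℕ}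
    (h : UkPoly (TpsGraph n p s) k = UkPoly (TpsGraph n p' s') k) (P : Multiset ℕ → Prop)
    [DecidablePred P] (hP : ∀ m, P m → Multiset.card m ≤ k + 1) :
    #{γ : CutData n p s | P (centerSize γ ::ₘ otherParts γ)} =
      #{γ : CutData n p' s' | P (centerSize γ ::ₘ otherParts γ)} := by
  have key : ∀ q t : Fin n → ℕ, #{γ : CutData n q t | P (centerSize γ ::ₘ otherParts γ)} =
      (UkPoly (TpsGraph n q t) k).countP P := by
    intro q t
    rw [Vtx.UkPoly_TpsGraph, Multiset.countP_filter, Multiset.countP_map, Finset.card,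
      Finset.filter_val]
    congr 1
    exact Multiset.filter_congr fun γ _ => ⟨fun h => ⟨h, hP _ h⟩, And.left⟩
  rw [key, key, h]

/-- The cut at the centre edges in `I` and at the middle edges of the paths in `D`. -/
def middleCut {n : ℕ} {p s : Fin n → ℕ} (I : Finset (Fin n)) (D : Finset (Σ i, Fin (p i))) :
    CutData n p s :=
  fun i => (decide (i ∈ I), fun j => if ⟨i, j⟩ ∈ D then {1} else ∅, fun _ => ∅)

namespace middleCut

variable {n : ℕ} {p s : Fin n → ℕ} (I : Finset (Fin n)) (D : Finset (Σ i, Fin (p i)))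

theorem injective {I I' : Finset (Fin n)} {D D' : Finset (Σ i, Fin (p i))}
    (h : (middleCut I D : CutData n p s) = middleCut I' D') : I = I' ∧ D = D' := by
  constructor
  · ext i
    have := congrArg Prod.fst (congrFun h i)
    simpa [middleCut] using this
  · ext ⟨i, j⟩
    have := congrFun (congrArg (fun c => c.2.1) (congrFun h i)) j
    simp only [middleCut] at this
    by_cases h1 : (⟨i, j⟩ : Σ i, Fin (p i)) ∈ D <;> by_cases h2 : (⟨i, j⟩ : Σ i, Fin (p i)) ∈ D' <;>
      simp_all

/-- The number of paths in `D` at the root `i`. -/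
def deg (i : Fin n) : ℕ := ∑ j : Fin (p i), if ⟨i, j⟩ ∈ D then 1 else 0

theorem deg_le (i : Fin n) : deg D i ≤ p i := by
  refine (Finset.sum_le_card_nsmul _ _ 1 fun j _ => ?_).trans (by simp)
  split_ifs <;> simp

theorem deg_eq_zero_iff (i : Fin n) : deg D i = 0 ↔ ∀ x ∈ D, x.1 ≠ i := by
  rw [deg, Finset.sum_eq_zero_iff]
  constructor
  · rintro h ⟨m, j⟩ hx rfl
    simpa [hx] using h j (mem_univ _)
  · intro h j _
    rw [if_neg fun hj => h _ hj rfl]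

theorem sum_deg : ∑ i, deg D i = #D := by
  simp only [deg]
  rw [← Fintype.sum_sigma (fun x : Σ i, Fin (p i) => if x ∈ D then 1 else 0)]
  simp

theorem rootRest_add (i : Fin n) :
    rootRest ((middleCut I D : CutData n p s) i) + 2 * deg D i = 3 * (p i + s i) := by
  have h1 : ∀ B : Prop, [Decidable B] →
      branchRest false (if B then {1} else ∅) + 2 * (if B then 1 else 0) = 3 := by
    intro B _
    split_ifs <;> decide
  have h2 : branchRest true ∅ = 3 := by decide
  simp only [rootRest, middleCut, h2, deg]
  rw [Finset.mul_sum, add_right_comm, ← Finset.sum_add_distrib]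
  simp only [h1]
  simp
  ring

theorem rootParts_eq (i : Fin n) :
    rootParts ((middleCut I D : CutData n p s) i) = Multiset.replicate (deg D i) 2 := by
  have h1 : ∀ B : Prop, [Decidable B] →
      branchParts false (if B then {1} else ∅) = (if B then 1 else 0) • {2} := by
    intro B _
    split_ifs <;> decide
  have h2 : branchParts true ∅ = 0 := by decide
  simp only [rootParts, middleCut, h2, deg, h1]
  rw [← Multiset.nsmul_singleton, Finset.sum_nsmul_assoc]
  simp

theorem otherParts_eq : otherParts (middleCut I D : CutData n p s) =
    I.val.map (fun i => 1 + rootRest ((middleCut I D : CutData n p s) i)) +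
      Multiset.replicate #D 2 := by
  rw [otherParts, Finset.sum_add_distrib, map_val_eq_sum_singleton]
  congr 1
  · rw [← Finset.sum_filter]
    refine Finset.sum_congr ?_ fun _ _ => rfl
    ext i
    simp [middleCut]
  · simp only [rootParts_eq, ← Multiset.nsmul_singleton, ← sum_deg, Finset.sum_nsmul_assoc]

theorem centerSize_eq : centerSize (middleCut I D : CutData n p s) =
    1 + ∑ i ∈ Iᶜ, (1 + rootRest ((middleCut I D : CutData n p s) i)) := by
  rw [centerSize]
  congr 1
  rw [← Finset.sum_subset (subset_univ Iᶜ)]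
  · refine Finset.sum_congr rfl fun i hi => ?_
    simp_all [middleCut]
  · intro i _ hi
    simp_all [middleCut]

end middleCut

/-- A cut that produces no pieces of size `1` or `3` only uses centre edges and middle edges. -/
theorem exists_eq_middleCut {n : ℕ} {p s : Fin n → ℕ} {γ : CutData n p s}
    (h1 : 1 ∉ otherParts γ) (h3 : 3 ∉ otherParts γ) : ∃ I D, γ = middleCut I D := by
  have hb : ∀ (st : Bool) (B : Finset (Fin 3)), 1 ∉ branchParts st B → 3 ∉ branchParts st B →
      B = ∅ ∨ (st = false ∧ B = {1}) := by decide
  have hpath : ∀ i j m, m ∉ otherParts γ → m ∉ branchParts false ((γ i).2.1 j) := by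
    intro i j m hm hmem
    refine hm (Multiset.mem_sum.2 ⟨i, mem_univ _, Multiset.mem_add.2 (Or.inr ?_)⟩)
    exact Multiset.mem_add.2 (Or.inl (Multiset.mem_sum.2 ⟨j, mem_univ _, hmem⟩))
  have hstar : ∀ i j m, m ∉ otherParts γ → m ∉ branchParts true ((γ i).2.2 j) := by
    intro i j m hm hmem
    refine hm (Multiset.mem_sum.2 ⟨i, mem_univ _, Multiset.mem_add.2 (Or.inr ?_)⟩)
    exact Multiset.mem_add.2 (Or.inr (Multiset.mem_sum.2 ⟨j, mem_univ _, hmem⟩))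
  refine ⟨univ.filter fun i => (γ i).1, univ.filter fun x => (γ x.1).2.1 x.2 = {1}, ?_⟩
  funext i
  refine Prod.ext ?_ (Prod.ext ?_ ?_)
  · simp [middleCut]
  · funext j
    rcases hb _ _ (hpath i j 1 h1) (hpath i j 3 h3) with h | ⟨-, h⟩
    · simp [middleCut, h]
    · simp [middleCut, h]
  · funext j
    simpa [middleCut] using hb _ _ (hstar i j 1 h1) (hstar i j 3 h3)

namespace middleCut

variable {n α : ℕ} {p s : Fin n → ℕ} (I : Finset (Fin n)) (D : Finset (Σ i, Fin (p i)))

theorem le_rootRest (hs : ∀ i, p i + s i = α) (i : Fin n) :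
    α ≤ rootRest ((middleCut I D : CutData n p s) i) := by
  have h1 := rootRest_add (s := s) I D i
  have h2 := deg_le D i
  have h3 := hs i
  omega

theorem add_le_centerSize (hs : ∀ i, p i + s i = α) :
    1 + #Iᶜ * (1 + α) ≤ centerSize (middleCut I D : CutData n p s) := by
  rw [centerSize_eq, ← smul_eq_mul]
  exact Nat.add_le_add_left (Finset.card_nsmul_le_sum _ _ _ fun i _ =>
    Nat.add_le_add_left (le_rootRest I D hs i) 1) 1

theorem card_otherParts :
    Multiset.card (otherParts (middleCut I D : CutData n p s)) = #I + #D := by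
  rw [otherParts_eq]
  simp

theorem mem_otherParts {m : ℕ} : m ∈ otherParts (middleCut I D : CutData n p s) ↔
    (∃ i ∈ I, 1 + rootRest ((middleCut I D : CutData n p s) i) = m) ∨ (#D ≠ 0 ∧ m = 2) := by
  rw [otherParts_eq, Multiset.mem_add, Multiset.mem_replicate, Multiset.mem_map]
  rfl

end middleCut

open middleCut

theorem card_cutData_single {n α : ℕ} (hn : 2 ≤ n) (hα : 0 < α) {p s : Fin n → ℕ}
    (hs : ∀ i, p i + s i = α) :
    #{γ : CutData n p s | Multiset.card (centerSize γ ::ₘ otherParts γ) = 2 ∧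
      2 ∈ centerSize γ ::ₘ otherParts γ ∧ 1 ∉ centerSize γ ::ₘ otherParts γ ∧
      3 ∉ centerSize γ ::ₘ otherParts γ} = ∑ i, p i := by
  have himg : ({γ : CutData n p s | Multiset.card (centerSize γ ::ₘ otherParts γ) = 2 ∧
      2 ∈ centerSize γ ::ₘ otherParts γ ∧ 1 ∉ centerSize γ ::ₘ otherParts γ ∧
      3 ∉ centerSize γ ::ₘ otherParts γ} : Finset (CutData n p s)) =
      (univ : Finset (Σ i, Fin (p i))).image fun x => middleCut ∅ {x} := by
    ext γ
    simp only [mem_filter, mem_univ, true_and, mem_image, Multiset.mem_cons, not_or,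
      Multiset.card_cons]
    constructor
    · rintro ⟨hc, h2, ⟨-, h1⟩, -, h3⟩
      obtain ⟨I, D, rfl⟩ := exists_eq_middleCut h1 h3
      rw [card_otherParts] at hc
      rcases Nat.eq_zero_or_pos #D with hD | hD
      · exfalso
        have hI : 1 ≤ #Iᶜ := by
          rw [Finset.card_compl, Fintype.card_fin]; omega
        have := add_le_centerSize (s := s) I D hs
        have := Nat.mul_le_mul_right (1 + α) hI
        rcases h2 with h2 | h2
        · omega
        · rcases (mem_otherParts I D).1 h2 with ⟨i, -, hi⟩ | ⟨h, -⟩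
          · have h1 := rootRest_add (s := s) I D i
            rw [hs] at h1
            have h2 : deg D i ≤ #D := by
              rw [← sum_deg]
              exact Finset.single_le_sum (f := deg D) (fun _ _ => Nat.zero_le _) (mem_univ i)
            omega
          · exact h hD
      · obtain rfl : I = ∅ := Finset.card_eq_zero.1 (by omega)
        obtain ⟨x, rfl⟩ := Finset.card_eq_one.1 (show #D = 1 by omega)
        exact ⟨x, rfl⟩
    · rintro ⟨x, rfl⟩
      have hc := add_le_centerSize (s := s) ∅ {x} hs
      rw [compl_empty, Finset.card_univ, Fintype.card_fin] at hc
      have := Nat.mul_le_mul hn (show 2 ≤ 1 + α by omega)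
      rw [card_otherParts]
      simp only [mem_otherParts]
      refine ⟨by simp, by simp, ⟨by omega, by simp⟩, by omega, by simp⟩
  rw [himg, Finset.card_image_of_injective _ fun x y h => by simpa using (injective h).2]
  simp

theorem card_cutData_multi {n α j : ℕ} (hn : 2 ≤ n) (hj : 2 ≤ j) (hjα : j ≤ α) {p s : Fin n → ℕ}
    (hs : ∀ i, p i + s i = α) :
    #{γ : CutData n p s | Multiset.card (centerSize γ ::ₘ otherParts γ) = j + 2 ∧
      Multiset.count 2 (centerSize γ ::ₘ otherParts γ) = j ∧
      1 + 3 * α ∈ centerSize γ ::ₘ otherParts γ ∧ 1 ∉ centerSize γ ::ₘ otherParts γ ∧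
      3 ∉ centerSize γ ::ₘ otherParts γ} = ∑ i, (∑ m, p m - p i).choose j := by
  have hcount : ∀ (I : Finset (Fin n)) (D : Finset (Σ i, Fin (p i))),
      centerSize (middleCut I D : CutData n p s) ≠ 2 → Multiset.count 2
        (centerSize (middleCut I D : CutData n p s) ::ₘ
          otherParts (middleCut I D : CutData n p s)) = #D := by
    intro I D hc
    rw [Multiset.count_cons_of_ne hc.symm, otherParts_eq, Multiset.count_add,
      Multiset.count_replicate_self, Multiset.count_eq_zero_of_notMem, zero_add]
    rw [Multiset.mem_map]
    rintro ⟨i, -, hi⟩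
    have := le_rootRest (s := s) I D hs i
    omega
  have himg : ({γ : CutData n p s | Multiset.card (centerSize γ ::ₘ otherParts γ) = j + 2 ∧
      Multiset.count 2 (centerSize γ ::ₘ otherParts γ) = j ∧
      1 + 3 * α ∈ centerSize γ ::ₘ otherParts γ ∧ 1 ∉ centerSize γ ::ₘ otherParts γ ∧
      3 ∉ centerSize γ ::ₘ otherParts γ} : Finset (CutData n p s)) =
      ((univ : Finset (Fin n)).sigma fun i => powersetCard j
        (univ.filter fun x : Σ i, Fin (p i) => x.1 ≠ i)).image fun x => middleCut {x.1} x.2 := by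
    ext γ
    simp only [mem_filter, mem_univ, true_and, mem_image, Multiset.mem_cons, not_or,
      Multiset.card_cons, mem_sigma, mem_powersetCard]
    constructor
    · rintro ⟨hc, h2, h4, ⟨hc1, h1⟩, -, h3⟩
      obtain ⟨I, D, rfl⟩ := exists_eq_middleCut h1 h3
      rw [card_otherParts] at hc
      have hcs := add_le_centerSize (s := s) I D hs
      have hI : 1 ≤ #Iᶜ := by
        rw [Nat.one_le_iff_ne_zero]
        intro h0
        rw [Finset.card_eq_zero] at h0
        rw [centerSize_eq, h0] at hc1
        simp at hc1
      have hmul := Nat.mul_le_mul_right (1 + α) hI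
      rw [hcount I D (by omega)] at h2
      obtain ⟨i, rfl⟩ := Finset.card_eq_one.1 (show #I = 1 by omega)
      have hi : deg D i = 0 := by
        rcases h4 with h4 | h4
        · exfalso
          have hsum : ∑ m ∈ {i}ᶜ, (1 + rootRest ((middleCut {i} D : CutData n p s) m)) +
              2 * ∑ m ∈ {i}ᶜ, deg D m = (n - 1) * (1 + 3 * α) := by
            rw [Finset.mul_sum, ← Finset.sum_add_distrib, Finset.sum_congr rfl fun m _ => by
              rw [add_assoc, rootRest_add, hs], Finset.sum_const, Finset.card_compl]
            simp
          have hdeg : ∑ m ∈ {i}ᶜ, deg D m ≤ #D := by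
            rw [← sum_deg]
            exact Finset.sum_le_sum_of_subset (subset_univ _)
          rw [centerSize_eq] at h4
          rcases Nat.lt_or_ge n 3 with hn3 | hn3
          · obtain rfl : n = 2 := by omega
            omega
          · have := Nat.mul_le_mul_right (1 + 3 * α) (show 2 ≤ n - 1 by omega)
            omega
        · rcases (mem_otherParts _ D).1 h4 with ⟨m, hm, h⟩ | ⟨-, h⟩
          · obtain rfl := Finset.mem_singleton.1 hm
            have := rootRest_add (s := s) {m} D m
            rw [hs] at this
            omega
          · omega
      refine ⟨⟨i, D⟩, ⟨fun x hx => ?_, h2⟩, rfl⟩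
      simpa using (deg_eq_zero_iff D i).1 hi x hx
    · rintro ⟨⟨i, D⟩, ⟨hD, hDj⟩, rfl⟩
      have hi : deg D i = 0 := (deg_eq_zero_iff D i).2 fun x hx => by simpa using hD hx
      have hR := rootRest_add (s := s) {i} D i
      rw [hs, hi] at hR
      have hcs := add_le_centerSize (s := s) {i} D hs
      have hI : 1 ≤ #({i}ᶜ : Finset (Fin n)) := by
        rw [Finset.card_compl, Fintype.card_fin, Finset.card_singleton]; omega
      have hmul := Nat.mul_le_mul_right (1 + α) hI
      dsimp only at hDj ⊢
      rw [card_otherParts, hcount _ D (by omega), Finset.card_singleton]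
      simp only [mem_otherParts, Finset.mem_singleton, exists_eq_left]
      omega
  rw [himg, Finset.card_image_of_injective, Finset.card_sigma]
  · refine Finset.sum_congr rfl fun i _ => ?_
    rw [Finset.card_powersetCard]
    congr 1
    rw [Finset.card_filter, Fintype.sum_sigma]
    refine eq_tsub_of_add_eq ?_
    rw [← Finset.sum_erase_add univ p (mem_univ i), ← Finset.filter_ne', Finset.sum_filter]
    congr 1
    refine Finset.sum_congr rfl fun m _ => ?_
    by_cases hm : m = i <;> simp [hm]
  · rintro ⟨i, D⟩ ⟨i', D'⟩ h
    obtain ⟨h1, h2⟩ := injective h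
    simp_all

theorem PTErel_of_UkPoly_eq {k n α : ℕ} (hk : 0 < k) (hn : 2 ≤ n) (hα : 0 < α)
    {p p' : Fin n → ℕ} (hp : ∀ i, p i ≤ α) (hp' : ∀ i, p' i ≤ α)
    (h : UkPoly (Ttree α p) (k + 1) = UkPoly (Ttree α p') (k + 1)) : PTErel k p p' := by
  have hs : ∀ i, p i + (α - p i) = α := fun i => Nat.add_sub_cancel' (hp i)
  have hs' : ∀ i, p' i + (α - p' i) = α := fun i => Nat.add_sub_cancel' (hp' i)
  refine PTErel_of_sum_choose_eq hp hp' ?_ fun j hj hjk hjα => ?_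
  · rw [← card_cutData_single hn hα hs, ← card_cutData_single hn hα hs']
    exact card_filter_eq_of_UkPoly_eq h (fun m => Multiset.card m = 2 ∧ 2 ∈ m ∧ 1 ∉ m ∧ 3 ∉ m)
      fun m hm => by omega
  · rw [← card_cutData_multi hn hj hjα hs, ← card_cutData_multi hn hj hjα hs']
    exact card_filter_eq_of_UkPoly_eq h (fun m => Multiset.card m = j + 2 ∧
      Multiset.count 2 m = j ∧ 1 + 3 * α ∈ m ∧ 1 ∉ m ∧ 3 ∉ m) fun m hm => by omega

end

/-- Two non-isomorphic PTE-trees `T_α(p)` and `T_α(p')` have the same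
`U_{k+1}`-polynomial if and only if `p =_k p'`, i.e. the sequences `p, p'` form a
solution of the Prouhet–Tarry–Escott problem of degree `k`. -/
theorem same_Uk_iff_PTE (k α n : ℕ) (hk : 0 < k) (hα : 0 < α)
    (p p' : Fin n → ℕ) (hp : AlphaCompatible α p) (hp' : AlphaCompatible α p')
    (hniso : IsEmpty (Ttree α p ≃g Ttree α p')) :
    UkPoly (Ttree α p) (k + 1) = UkPoly (Ttree α p') (k + 1) ↔ PTErel k p p' := by
  exact ⟨PTErel_of_UkPoly_eq hk hp.1 hα hp.2 hp'.2, UkPoly_eq_of_PTErel hk hp.2 hp'.2⟩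
end

section
/- Let k and α be positive integers and let p and p' be two α-compatible sequences of non-negative integers of the same length n with p =_k p'. Then U_{k+1}(T_α(p)) = U_{k+1}(T_α(p')), i.e. the trees T_α(p) and T_α(p') have the same U_{k+1}-polynomial. -/
open scoped Classical

/-- A finite rooted tree given by a parent function that decreases a rank off the root. -/
structure ParentTree (V : Type) where
  root : V
  par : V → V
  rank : V → ℕ
  rank_par_lt : ∀ v, v ≠ root → rank (par v) < rank v

namespace ParentTree

variable {V : Type} (T : ParentTree V)

/-- The highest ancestor of `v` reachable without crossing the edge above a vertex of `B`. -/
noncomputable def top (B : Finset V) (v : V) : V :=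
  if h : v = T.root ∨ v ∈ B then v else top B (T.par v)
termination_by T.rank v
decreasing_by exact T.rank_par_lt v (not_or.1 h).1

lemma top_of_mem {B : Finset V} {v : V} (h : v = T.root ∨ v ∈ B) : T.top B v = v := by
  rw [top, dif_pos h]

lemma top_of_notMem {B : Finset V} {v : V} (h : ¬(v = T.root ∨ v ∈ B)) :
    T.top B v = T.top B (T.par v) := by
  rw [top, dif_neg h]

lemma top_mem (B : Finset V) (v : V) : T.top B v = T.root ∨ T.top B v ∈ B := by
  induction hr : T.rank v using Nat.strong_induction_on generalizing v with
  | _ r ih =>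
    by_cases h : v = T.root ∨ v ∈ B
    · rwa [top_of_mem T h]
    · rw [top_of_notMem T h]
      exact ih _ (hr ▸ T.rank_par_lt v (not_or.1 h).1) _ rfl

/-- Cutting above a further vertex `u` of maximal rank does not affect the other vertices. -/
lemma top_insert {L B : Finset V} {u : V}
    (hclosed : ∀ w ∈ L, T.par w = T.root ∨ T.par w ∈ L)
    (hmax : ∀ w ∈ L, T.rank w ≤ T.rank u) (v : V) (hv : v = T.root ∨ v ∈ L) (hvu : v ≠ u) :
    T.top (insert u B) v = T.top B v := by
  induction hr : T.rank v using Nat.strong_induction_on generalizing v with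
  | _ r ih =>
    by_cases h : v = T.root ∨ v ∈ B
    · rw [top_of_mem T h, top_of_mem T (h.imp_right (Finset.mem_insert_of_mem))]
    · have h' : ¬(v = T.root ∨ v ∈ insert u B) := by
        simpa [hvu] using h
      obtain ⟨h1, h2⟩ := not_or.1 h
      have hvL := hv.resolve_left h1
      have hlt := T.rank_par_lt v h1
      rw [top_of_notMem T h, top_of_notMem T h']
      refine ih _ (hr ▸ hlt) _ (hclosed v hvL) ?_ rfl
      intro he
      have := hmax v hvL
      rw [he] at hlt
      omega

section GeneratingFunction

variable [Fintype V] {R S : Type} [CommRing R] [CommRing S] [Algebra R S]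
  (φ : S →ₗ[R] R) (z : S) (t : R) (W : V → S)

/-- The contribution of a vertex together with all its child subtrees outside `L`, each of which
is either kept or cut off. -/
noncomputable def partialWeight (L : Finset V) (v : V) : S :=
  z * ∏ u with u ∉ L ∧ u ≠ T.root ∧ T.par u = v, (W u + algebraMap R S (t * φ (W u)))

lemma partialWeight_insert {L : Finset V} {u : V} (huL : u ∉ L) (hu : u ≠ T.root) (v : V) :
    T.partialWeight φ z t W L v = T.partialWeight φ z t W (insert u L) v *
      if T.par u = v then W u + algebraMap R S (t * φ (W u)) else 1 := by
  unfold partialWeight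
  rw [mul_assoc]
  congr 1
  split_ifs with h
  · have : Finset.univ.filter (fun w => w ∉ L ∧ w ≠ T.root ∧ T.par w = v) =
        insert u (Finset.univ.filter (fun w => w ∉ insert u L ∧ w ≠ T.root ∧ T.par w = v)) := by
      ext w
      by_cases hw : w = u
      · subst hw; simp [huL, hu, h]
      · simp [hw]
    rw [this, Finset.prod_insert (by simp), mul_comm]
  · rw [mul_one]
    refine Finset.prod_congr ?_ fun _ _ => rfl
    ext w
    by_cases hw : w = u
    · subst hw; simp [h]
    · simp [hw]

/-- Cutting off the edges above the vertices of `B ⊆ L`, summed over `B`, computes the weight of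
the root, where the weights satisfy the branching recursion. -/
theorem sum_cuts_of_closed
    (hW : ∀ v, W v = z * ∏ u with u ≠ T.root ∧ T.par u = v, (W u + algebraMap R S (t * φ (W u))))
    (L : Finset V) (hroot : T.root ∉ L) (hclosed : ∀ w ∈ L, T.par w = T.root ∨ T.par w ∈ L) :
    ∑ B ∈ L.powerset, t ^ B.card * ∏ s ∈ insert T.root B,
      φ (∏ v ∈ insert T.root L with T.top B v = s, T.partialWeight φ z t W L v) =
    φ (W T.root) := by
  induction hn : L.card generalizing L with
  | zero =>
    obtain rfl := Finset.card_eq_zero.1 hn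
    simp only [Finset.powerset_empty, Finset.sum_singleton, Finset.card_empty, pow_zero, one_mul,
      insert_empty_eq, Finset.prod_singleton]
    rw [Finset.filter_true_of_mem (by simp [top_of_mem]), Finset.prod_singleton]
    conv_rhs => rw [hW]
    simp [partialWeight]
  | succ n ih =>
    obtain ⟨u, huL, hmax⟩ := L.exists_max_image T.rank (Finset.card_pos.1 (by omega))
    obtain ⟨L', huL', rfl⟩ : ∃ L', u ∉ L' ∧ insert u L' = L :=
      ⟨L.erase u, by simp, Finset.insert_erase huL⟩
    have hu : u ≠ T.root := fun h => hroot (h ▸ huL)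
    have hparne : ∀ w ∈ insert u L', T.par w ≠ u := by
      intro w hw he
      have h1 := T.rank_par_lt w (fun h => hroot (h ▸ hw))
      have h2 := hmax w hw
      rw [he] at h1
      omega
    have hroot' : T.root ∉ L' := fun h => hroot (Finset.mem_insert_of_mem h)
    have hpar : ∀ w ∈ insert u L', T.par w = T.root ∨ T.par w ∈ L' := by
      intro w hw
      exact (hclosed w hw).imp_right fun h => (Finset.mem_insert.1 h).resolve_left (hparne w hw)
    rw [← ih L' hroot' (fun w hw => hpar w (Finset.mem_insert_of_mem hw))
      (by rw [Finset.card_insert_of_notMem huL'] at hn; omega),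
      Finset.sum_powerset_insert huL', ← Finset.sum_add_distrib]
    refine Finset.sum_congr rfl fun B hB => ?_
    rw [Finset.mem_powerset] at hB
    have huB : u ∉ B := fun h => huL' (hB h)
    have huD : u ∉ insert T.root L' := by simp [hu, huL']
    have hWu : T.partialWeight φ z t W (insert u L') u = W u := by
      rw [hW u, partialWeight]
      congr 1
      refine Finset.prod_congr ?_ fun _ _ => rfl
      ext w
      simp only [Finset.mem_filter, Finset.mem_univ, true_and]
      exact ⟨fun h => h.2, fun h => ⟨fun hw => hparne w hw h.2, h⟩⟩
    have htopu : T.top B u = T.top B (T.par u) := top_of_notMem T (by simp [hu, huB])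
    have hs0 : T.top B u ∈ insert T.root B := Finset.mem_insert.2 (T.top_mem B u)
    have huS : u ∉ insert T.root B := by simp [hu, huB]
    set M := T.partialWeight φ z t W (insert u L') with hM
    set N : V → S := fun s => ∏ v ∈ insert T.root L' with T.top B v = s, M v with hN
    have hkeep : ∀ s, ∏ v ∈ insert T.root (insert u L') with T.top B v = s, M v =
        N s * if T.top B u = s then W u else 1 := by
      intro s
      rw [Finset.insert_comm, Finset.filter_insert]
      split_ifs with h
      · rw [Finset.prod_insert (by simp [hu, huL']), hWu, mul_comm]
      · rw [mul_one]
    have htopD : ∀ v ∈ insert T.root L', T.top (insert u B) v = T.top B v := by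
      intro v hv
      refine top_insert T hclosed hmax v ?_ (fun h => huD (h ▸ hv))
      exact (Finset.mem_insert.1 hv).imp_right Finset.mem_insert_of_mem
    have hcut : ∀ s ∈ insert T.root B,
        ∏ v ∈ insert T.root (insert u L') with T.top (insert u B) v = s, M v = N s := by
      intro s hs
      rw [Finset.insert_comm, Finset.filter_insert, if_neg]
      · exact Finset.prod_congr (Finset.filter_congr fun v hv => by rw [htopD v hv]) fun _ _ => rfl
      · rw [top_of_mem T (by simp)]
        exact fun h => huS (h ▸ hs)
    have hcutu : ∏ v ∈ insert T.root (insert u L') with T.top (insert u B) v = u, M v = W u := by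
      rw [Finset.insert_comm, Finset.filter_insert, if_pos (top_of_mem T (by simp)),
        Finset.filter_false_of_mem, Finset.prod_insert (by simp), hWu]
      · simp
      · intro v hv h
        rw [htopD v hv] at h
        exact huS (h ▸ Finset.mem_insert.2 (T.top_mem B v))
    have hmerge : ∀ s, ∏ v ∈ insert T.root L' with T.top B v = s, T.partialWeight φ z t W L' v =
        N s * if T.top B u = s then W u + algebraMap R S (t * φ (W u)) else 1 := by
      intro s
      simp only [partialWeight_insert T φ z t W huL' hu, Finset.prod_mul_distrib, ← hM]
      congr 1
      rw [Finset.prod_ite_eq, htopu]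
      have hp : T.par u ∈ insert T.root L' := Finset.mem_insert.2 (hpar u huL)
      simp only [Finset.mem_filter, hp, true_and]
    rw [Finset.insert_comm T.root u B, Finset.prod_insert huS, hcutu,
      Finset.prod_congr rfl fun s hs => congrArg φ (hcut s hs),
      Finset.card_insert_of_notMem huB]
    simp only [hkeep, hmerge]
    rw [← Finset.mul_prod_erase _ _ hs0, ← Finset.mul_prod_erase _ _ hs0,
      ← Finset.mul_prod_erase _ _ hs0]
    have herase : ∀ Y : S, ∏ s ∈ (insert T.root B).erase (T.top B u),
        φ (N s * if T.top B u = s then Y else 1) =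
        ∏ s ∈ (insert T.root B).erase (T.top B u), φ (N s) := by
      intro Y
      refine Finset.prod_congr rfl fun s hs => ?_
      rw [if_neg (Finset.ne_of_mem_erase hs).symm, mul_one]
    rw [herase, herase, if_pos rfl, if_pos rfl, mul_add, map_add, mul_comm (N _) (algebraMap R S _),
      ← Algebra.smul_def, map_smul, smul_eq_mul]
    ring

/-- The generating function of all edge cuts of a rooted tree is the weight of its root. -/
theorem sum_cuts
    (hW : ∀ v, W v = z * ∏ u with u ≠ T.root ∧ T.par u = v,
      (W u + algebraMap R S (t * φ (W u)))) :
    ∑ B ∈ (Finset.univ.erase T.root).powerset, t ^ B.card * ∏ s ∈ insert T.root B,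
      φ (z ^ (Finset.univ.filter fun v => T.top B v = s).card) = φ (W T.root) := by
  rw [← T.sum_cuts_of_closed φ z t W hW (Finset.univ.erase T.root) (by simp) (by simp [em])]
  refine Finset.sum_congr rfl fun B _ => ?_
  congr 1
  refine Finset.prod_congr rfl fun s _ => ?_
  have h : ∀ v, T.partialWeight φ z t W (Finset.univ.erase T.root) v = z := by
    intro v
    rw [partialWeight, Finset.filter_false_of_mem, Finset.prod_empty, mul_one]
    simp +contextual
  simp only [h, Finset.prod_const, Finset.insert_erase (Finset.mem_univ T.root)]

end GeneratingFunction

section Graph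

/-- The edge joining a vertex to its parent. -/
def parentEdge (v : V) : Sym2 V := s(v, T.par v)

/-- The graph `G` has exactly the edges joining the vertices other than the root to their
parents. -/
def Represents (G : SimpleGraph V) : Prop :=
  ∀ u v, G.Adj u v ↔ (u ≠ T.root ∧ T.par u = v) ∨ (v ≠ T.root ∧ T.par v = u)

lemma parentEdge_inj {u v : V} (hu : u ≠ T.root) (hv : v ≠ T.root)
    (h : T.parentEdge u = T.parentEdge v) : u = v := by
  rcases Sym2.eq_iff.1 h with h | ⟨h1, h2⟩
  · exact h.1
  · have h3 := T.rank_par_lt u hu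
    have h4 := T.rank_par_lt v hv
    rw [h2] at h3
    rw [← h1] at h4
    omega

variable {T} {G : SimpleGraph V}

lemma Represents.edgeFinset [Fintype V] (hG : T.Represents G) :
    G.edgeFinset = (Finset.univ.erase T.root).image T.parentEdge := by
  ext e
  induction e with
  | _ u v =>
    simp only [SimpleGraph.mem_edgeFinset, SimpleGraph.mem_edgeSet, hG u v, Finset.mem_image,
      Finset.mem_erase, Finset.mem_univ, and_true, parentEdge, Sym2.eq_iff]
    constructor
    · rintro (⟨h1, h2⟩ | ⟨h1, h2⟩)
      · exact ⟨u, h1, Or.inl ⟨rfl, h2⟩⟩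
      · exact ⟨v, h1, Or.inr ⟨rfl, h2⟩⟩
    · rintro ⟨w, hw, ⟨rfl, h⟩ | ⟨rfl, h⟩⟩
      · exact Or.inl ⟨hw, h⟩
      · exact Or.inr ⟨hw, h⟩

lemma Represents.deleteEdges_adj_par (hG : T.Represents G) {B : Finset V} (hB : T.root ∉ B)
    {v : V} (hv : v ≠ T.root) (hvB : v ∉ B) :
    (G.deleteEdges ↑(B.image T.parentEdge)).Adj v (T.par v) := by
  rw [SimpleGraph.deleteEdges_adj]
  refine ⟨(hG _ _).2 (Or.inl ⟨hv, rfl⟩), ?_⟩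
  simp only [Finset.coe_image, Set.mem_image, Finset.mem_coe]
  rintro ⟨w, hw, he⟩
  exact hvB (T.parentEdge_inj (fun h => hB (h ▸ hw)) hv he ▸ hw)

lemma Represents.reachable_top (hG : T.Represents G) {B : Finset V} (hB : T.root ∉ B) (v : V) :
    (G.deleteEdges ↑(B.image T.parentEdge)).Reachable v (T.top B v) := by
  induction hr : T.rank v using Nat.strong_induction_on generalizing v with
  | _ r ih =>
    by_cases h : v = T.root ∨ v ∈ B
    · rw [top_of_mem T h]
    · rw [top_of_notMem T h]
      obtain ⟨h1, h2⟩ := not_or.1 h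
      exact (hG.deleteEdges_adj_par hB h1 h2).reachable.trans
        (ih _ (hr ▸ T.rank_par_lt v h1) _ rfl)

lemma Represents.top_eq_of_adj (hG : T.Represents G) {B : Finset V} {u v : V}
    (h : (G.deleteEdges ↑(B.image T.parentEdge)).Adj u v) : T.top B u = T.top B v := by
  have key : ∀ x y, x ≠ T.root → T.par x = y → s(x, y) ∉ (B.image T.parentEdge : Finset _) →
      T.top B x = T.top B y := by
    rintro x y hx rfl hn
    refine top_of_notMem T (not_or.2 ⟨hx, fun hxB => hn ?_⟩)
    exact Finset.mem_image_of_mem T.parentEdge hxB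
  rw [SimpleGraph.deleteEdges_adj] at h
  rcases (hG u v).1 h.1 with ⟨h1, h2⟩ | ⟨h1, h2⟩
  · exact key u v h1 h2 h.2
  · exact (key v u h1 h2 (by rw [Sym2.eq_swap]; exact h.2)).symm

lemma Represents.reachable_iff (hG : T.Represents G) {B : Finset V} (hB : T.root ∉ B) (u v : V) :
    (G.deleteEdges ↑(B.image T.parentEdge)).Reachable u v ↔ T.top B u = T.top B v := by
  constructor
  · rintro ⟨w⟩
    induction w with
    | nil => rfl
    | cons h _ ih => exact (hG.top_eq_of_adj h).trans ih
  · intro h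
    exact (hG.reachable_top hB u).trans (h ▸ (hG.reachable_top hB v).symm)

/-- After cutting the edges above the vertices of `B`, every component has a unique highest
vertex, which is the root or a vertex of `B`. -/
theorem Represents.componentSizes_deleteEdges [Fintype V] (hG : T.Represents G) {B : Finset V}
    (hB : T.root ∉ B) :
    componentSizes (G.deleteEdges ↑(B.image T.parentEdge)) =
      (insert T.root B).val.map fun s => (Finset.univ.filter fun v => T.top B v = s).card := by
  set H := G.deleteEdges ↑(B.image T.parentEdge) with hH
  have hinj : Set.InjOn H.connectedComponentMk ↑(insert T.root B) := by
    intro x hx y hy hxy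
    have h := (hG.reachable_iff hB x y).1 (SimpleGraph.ConnectedComponent.eq.1 hxy)
    rwa [top_of_mem T (by simpa using hx), top_of_mem T (by simpa using hy)] at h
  have huniv : ∀ inst : Fintype H.ConnectedComponent, @Finset.univ _ inst =
      (insert T.root B).image H.connectedComponentMk := by
    intro _
    refine (Finset.eq_univ_of_forall fun c => ?_).symm
    induction c using SimpleGraph.ConnectedComponent.ind with
    | _ v =>
      exact Finset.mem_image.2 ⟨T.top B v, Finset.mem_insert.2 (T.top_mem B v),
        SimpleGraph.ConnectedComponent.eq.2 (hG.reachable_top hB v).symm⟩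
  rw [componentSizes, huniv, Finset.image_val_of_injOn hinj, Multiset.map_map]
  refine Multiset.map_congr rfl fun s hs => ?_
  have hs' : T.top B s = s := top_of_mem T (by simpa using hs)
  rw [Function.comp_apply, Nat.card_eq_fintype_card, ← Set.toFinset_card]
  congr 1
  ext v
  simp only [Set.mem_toFinset, SimpleGraph.ConnectedComponent.mem_supp_iff,
    SimpleGraph.ConnectedComponent.eq, Finset.mem_filter, Finset.mem_univ, true_and]
  rw [hH, hG.reachable_iff hB, hs']

end Graph

end ParentTree

/-- Formal power sums determine the elementary symmetric values over a `ℚ`-algebra. -/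
lemma aeval_esymm_eq_of_sum_pow_eq {σ K : Type} [Fintype σ] [CommRing K] [Algebra ℚ K]
    {a b : σ → K} (h : ∀ m, ∑ i, a i ^ m = ∑ i, b i ^ m) (r : ℕ) :
    MvPolynomial.aeval a (MvPolynomial.esymm σ ℚ r) =
      MvPolynomial.aeval b (MvPolynomial.esymm σ ℚ r) := by
  induction r using Nat.strong_induction_on with
  | _ r ih =>
    rcases Nat.eq_zero_or_pos r with rfl | hr
    · simp
    have hps : ∀ m, MvPolynomial.aeval a (MvPolynomial.psum σ ℚ m) =
        MvPolynomial.aeval b (MvPolynomial.psum σ ℚ m) := by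
      intro m
      simpa [MvPolynomial.psum] using h m
    have key : ((r : ℚ) • MvPolynomial.aeval a (MvPolynomial.esymm σ ℚ r)) =
        (r : ℚ) • MvPolynomial.aeval b (MvPolynomial.esymm σ ℚ r) := by
      rw [← map_smul, ← map_smul, Nat.cast_smul_eq_nsmul, nsmul_eq_mul,
        MvPolynomial.mul_esymm_eq_sum σ ℚ r]
      simp only [map_mul, map_sum, map_pow, map_neg, map_one, hps]
      congr 1
      refine Finset.sum_congr rfl fun x hx => ?_
      rw [ih x.1 (Finset.mem_filter.1 hx).2]
    have hr' : (r : ℚ) ≠ 0 := by positivity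
    simpa [smul_smul, inv_mul_cancel₀ hr'] using congrArg (fun y => (r : ℚ)⁻¹ • y) key

lemma prod_add_mul_eq_sum_esymm {σ A : Type} [Fintype σ] [CommRing A] [Algebra ℚ A]
    (κ t : A) (a : σ → A) :
    ∏ i, (t * a i + κ) = ∑ r ∈ Finset.range (Fintype.card σ + 1),
      t ^ r * κ ^ (Fintype.card σ - r) * MvPolynomial.aeval a (MvPolynomial.esymm σ ℚ r) := by
  rw [Finset.prod_add, Finset.sum_powerset]
  refine Finset.sum_congr rfl fun r _ => ?_
  simp only [MvPolynomial.esymm, map_sum, map_prod, MvPolynomial.aeval_X, Finset.mul_sum]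
  refine Finset.sum_congr rfl fun s hs => ?_
  rw [Finset.mem_powersetCard] at hs
  rw [Finset.prod_mul_distrib, Finset.prod_const, Finset.prod_const, hs.2,
    Finset.card_sdiff_of_subset hs.1, hs.2, Finset.card_univ]
  ring

/-- If the power sums of two families agree modulo `t ^ (k + 1)`, then the products
`∏ (t * a i + κ)` agree modulo `t ^ (k + 2)`. -/
lemma pow_dvd_prod_sub_prod {σ A : Type} [Fintype σ] [CommRing A] [Algebra ℚ A]
    (κ t : A) (k : ℕ) {a b : σ → A} (h : ∀ m, t ^ (k + 1) ∣ ∑ i, a i ^ m - ∑ i, b i ^ m) :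
    t ^ (k + 2) ∣ ∏ i, (t * a i + κ) - ∏ i, (t * b i + κ) := by
  have hes : ∀ r, t ^ (k + 1) ∣ MvPolynomial.aeval a (MvPolynomial.esymm σ ℚ r) -
      MvPolynomial.aeval b (MvPolynomial.esymm σ ℚ r) := by
    intro r
    let π := Ideal.Quotient.mkₐ ℚ (Ideal.span {t ^ (k + 1)})
    have hπ : ∀ x y, π x = π y ↔ t ^ (k + 1) ∣ x - y := fun x y => by
      rw [← Ideal.mem_span_singleton]
      exact Ideal.Quotient.eq
    have := aeval_esymm_eq_of_sum_pow_eq (a := fun i => π (a i)) (b := fun i => π (b i))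
      (fun m => by
        simp only [← map_pow, ← map_sum]
        exact (hπ _ _).2 (h m)) r
    rw [← hπ]
    have hc : ∀ c : σ → A, ∀ f : MvPolynomial σ ℚ,
        MvPolynomial.aeval (fun i => π (c i)) f = π (MvPolynomial.aeval c f) := by
      intro c f
      rw [← AlgHom.comp_apply, MvPolynomial.comp_aeval]
    rwa [hc, hc] at this
  rw [prod_add_mul_eq_sum_esymm, prod_add_mul_eq_sum_esymm, ← Finset.sum_sub_distrib]
  refine Finset.dvd_sum fun r _ => ?_
  rw [← mul_sub]
  rcases r with _ | r
  · simp
  · rw [pow_succ' t r, pow_succ' t (k + 1), mul_assoc, mul_assoc]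
    exact mul_dvd_mul_left t (((hes _).mul_left _).mul_left _)

section Interpolation

variable {A : Type} [CommRing A]

/-- On `q ≤ α`, the function `g` agrees with a polynomial in `q * t`. -/
def IsPolynomialIn (t : A) (α : ℕ) (g : ℕ → A) : Prop :=
  ∃ f : Polynomial A, ∀ q ≤ α, g q = f.eval ((q : A) * t)

lemma IsPolynomialIn.mul {t : A} {α : ℕ} {g h : ℕ → A} (hg : IsPolynomialIn t α g)
    (hh : IsPolynomialIn t α h) : IsPolynomialIn t α fun q => g q * h q := by
  obtain ⟨f₁, h₁⟩ := hg
  obtain ⟨f₂, h₂⟩ := hh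
  exact ⟨f₁ * f₂, fun q hq => by simp [h₁ q hq, h₂ q hq]⟩

lemma IsPolynomialIn.pow {t : A} {α : ℕ} {g : ℕ → A} (hg : IsPolynomialIn t α g) (m : ℕ) :
    IsPolynomialIn t α fun q => g q ^ m := by
  obtain ⟨f, h⟩ := hg
  exact ⟨f ^ m, fun q hq => by simp [h q hq]⟩

lemma isPolynomialIn_sum_choose [Algebra ℚ A] (t : A) (α : ℕ) (c : ℕ → A) :
    IsPolynomialIn t α fun q => ∑ j ∈ Finset.range (α + 1), (q.choose j : A) * (t ^ j * c j) := by
  refine ⟨∑ j ∈ Finset.range (α + 1), Polynomial.C (algebraMap ℚ A (j.factorial : ℚ)⁻¹ * c j) *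
    ∏ i ∈ Finset.range j, (Polynomial.X - Polynomial.C ((i : A) * t)), fun q _ => ?_⟩
  rw [Polynomial.eval_finsetSum]
  refine Finset.sum_congr rfl fun j _ => ?_
  have h1 : ∏ i ∈ Finset.range j, ((q : A) * t - (i : A) * t) =
      t ^ j * (q.descFactorial j : A) := by
    simp only [← sub_mul, Finset.prod_mul_distrib, Finset.prod_const, Finset.card_range]
    rw [mul_comm]
    congr 1
    rw [← descPochhammer_eval_eq_descFactorial, descPochhammer_eval_eq_prod_range]
  have h2 : algebraMap ℚ A (j.factorial : ℚ)⁻¹ * (j.factorial : A) = 1 := by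
    rw [← map_natCast (algebraMap ℚ A), ← map_mul, inv_mul_cancel₀, map_one]
    exact_mod_cast j.factorial_ne_zero
  simp only [Polynomial.eval_mul, Polynomial.eval_C, Polynomial.eval_prod, Polynomial.eval_sub,
    Polynomial.eval_X]
  rw [h1, Nat.descFactorial_eq_factorial_mul_choose, Nat.cast_mul]
  linear_combination (-(q.choose j : A) * t ^ j * c j) * h2

lemma pow_mul_pow_eq_sum_choose {x y t d : A} (h : x = y + t * d) {α q : ℕ} (hq : q ≤ α) :
    x ^ q * y ^ (α - q) =
      ∑ j ∈ Finset.range (α + 1), (q.choose j : A) * (t ^ j * (d ^ j * y ^ (α - j))) := by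
  rw [h, add_comm, add_pow, Finset.sum_mul]
  rw [← Finset.sum_subset (Finset.range_mono (Nat.succ_le_succ hq))]
  · refine Finset.sum_congr rfl fun j hj => ?_
    have hj' : j ≤ q := Nat.lt_succ_iff.1 (Finset.mem_range.1 hj)
    rw [show α - j = (q - j) + (α - q) by omega, pow_add]
    ring
  · intro j _ hj
    rw [Nat.choose_eq_zero_of_lt (by simpa using hj)]
    simp

/-- A polynomial in `q * t` has power sums modulo `t ^ (k + 1)` determined by the power sums of
order at most `k`. -/
lemma IsPolynomialIn.pow_dvd_sum_sub_sum {t : A} {α k n : ℕ} {g : ℕ → A}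
    (hg : IsPolynomialIn t α g) {p p' : Fin n → ℕ} (hp : ∀ i, p i ≤ α) (hp' : ∀ i, p' i ≤ α)
    (h : PTErel k p p') : t ^ (k + 1) ∣ ∑ i, g (p i) - ∑ i, g (p' i) := by
  obtain ⟨f, hf⟩ := hg
  have hsum : ∀ q : Fin n → ℕ, (∀ i, q i ≤ α) → ∑ i, g (q i) =
      ∑ j ∈ Finset.range (f.natDegree + 1), f.coeff j * t ^ j * ((∑ i, q i ^ j : ℕ) : A) := by
    intro q hq
    simp only [fun i => hf _ (hq i), Polynomial.eval_eq_sum_range]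
    rw [Finset.sum_comm]
    refine Finset.sum_congr rfl fun j _ => ?_
    rw [Nat.cast_sum, Finset.mul_sum]
    refine Finset.sum_congr rfl fun i _ => ?_
    rw [Nat.cast_pow]
    ring
  rw [hsum p hp, hsum p' hp', ← Finset.sum_sub_distrib]
  refine Finset.dvd_sum fun j _ => ?_
  rw [← mul_sub]
  rcases Nat.eq_zero_or_pos j with rfl | hj
  · simp
  rcases le_or_gt j k with hjk | hjk
  · rw [h j hj hjk, sub_self, mul_zero]
    exact dvd_zero _
  · exact ((pow_dvd_pow t hjk).mul_left _).mul_right _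

end Interpolation

/-- The branch polynomials built from two gadgets that agree modulo `t` have products that agree
modulo `t ^ (k + 2)`. -/
lemma pow_dvd_branch_prod_sub {R A : Type} [CommRing R] [CommRing A] [IsDomain A] [Algebra R A]
    [Algebra ℚ A] (φ : A →ₗ[R] R) (z x y d : A) (t : R) (hxy : x = y + algebraMap R A t * d)
    (hprime : Prime (algebraMap R A t)) (hx : ¬ algebraMap R A t ∣ x)
    (hy : ¬ algebraMap R A t ∣ y) {k α n : ℕ} (hk : 0 < k) {p p' : Fin n → ℕ}
    (hp : ∀ i, p i ≤ α) (hp' : ∀ i, p' i ≤ α) (h : PTErel k p p') :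
    algebraMap R A t ^ (k + 2) ∣
      ∏ i, (z * (x ^ p i * y ^ (α - p i)) +
        algebraMap R A (t * φ (z * (x ^ p i * y ^ (α - p i))))) -
      ∏ i, (z * (x ^ p' i * y ^ (α - p' i)) +
        algebraMap R A (t * φ (z * (x ^ p' i * y ^ (α - p' i))))) := by
  set τ := algebraMap R A t with hτ
  set F : ℕ → A := fun q => algebraMap R A (φ (z * (x ^ q * y ^ (α - q)))) with hF
  set D : ℕ → A := fun q => y ^ q * x ^ (α - q) with hD
  have hFpoly : IsPolynomialIn τ α F := by
    obtain ⟨f, hf⟩ := isPolynomialIn_sum_choose τ α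
      fun j => algebraMap R A (φ (z * (d ^ j * y ^ (α - j))))
    refine ⟨f, fun q hq => ?_⟩
    rw [← hf q hq, hF]
    simp only [pow_mul_pow_eq_sum_choose hxy hq, Finset.mul_sum, map_sum]
    refine Finset.sum_congr rfl fun j _ => ?_
    rw [show z * ((q.choose j : A) * (τ ^ j * (d ^ j * y ^ (α - j)))) =
      ((q.choose j : R) * t ^ j) • (z * (d ^ j * y ^ (α - j))) by
        rw [Algebra.smul_def, map_mul, map_pow, map_natCast]; ring, map_smul, smul_eq_mul,
      map_mul, map_mul, map_pow, map_natCast]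
    ring
  have hDpoly : IsPolynomialIn τ α D := by
    obtain ⟨f, hf⟩ := isPolynomialIn_sum_choose τ α fun j => (-d) ^ j * x ^ (α - j)
    refine ⟨f, fun q hq => ?_⟩
    rw [← hf q hq]
    exact pow_mul_pow_eq_sum_choose (by rw [hxy]; ring) hq
  have hbranch : ∀ q ≤ α, (z * (x ^ q * y ^ (α - q)) +
      algebraMap R A (t * φ (z * (x ^ q * y ^ (α - q))))) * D q =
      τ * (F q * D q) + z * (x * y) ^ α := by
    intro q hq
    have h1 : (x * y) ^ α = (x ^ q * x ^ (α - q)) * (y ^ q * y ^ (α - q)) := by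
      rw [← pow_add, ← pow_add, Nat.add_sub_cancel' hq, mul_pow]
    rw [h1, map_mul, ← hτ]
    simp only [hF, hD]
    ring
  have hsum : ∑ i, p i = ∑ i, p' i := by simpa using h 1 le_rfl hk
  have hDprod : ∀ q : Fin n → ℕ, (∀ i, q i ≤ α) →
      ∏ i, D (q i) = y ^ (∑ i, q i) * x ^ (n * α - ∑ i, q i) := by
    intro q hq
    simp only [hD]
    rw [Finset.prod_mul_distrib, Finset.prod_pow_eq_pow_sum, Finset.prod_pow_eq_pow_sum,
      Finset.sum_tsub_distrib _ fun i _ => hq i]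
    simp
  have hDeq : ∏ i, D (p i) = ∏ i, D (p' i) := by rw [hDprod p hp, hDprod p' hp', hsum]
  refine hprime.pow_dvd_of_dvd_mul_left (a := ∏ i, D (p i)) _ ?_ ?_
  · rw [hDprod p hp]
    intro hdvd
    rcases hprime.dvd_or_dvd hdvd with h' | h'
    · exact hy (hprime.dvd_of_dvd_pow h')
    · exact hx (hprime.dvd_of_dvd_pow h')
  · rw [mul_sub, mul_comm, ← Finset.prod_mul_distrib, hDeq, mul_comm (∏ i, D (p' i)),
      ← Finset.prod_mul_distrib, Finset.prod_congr rfl fun i _ => hbranch _ (hp i),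
      Finset.prod_congr rfl fun i _ => hbranch _ (hp' i)]
    exact pow_dvd_prod_sub_prod _ _ _ fun m =>
      ((hFpoly.mul hDpoly).pow m).pow_dvd_sum_sub_sum hp hp' h

section EdgeCuts

open Polynomial

/-- The monomial `x_λ` attached to a multiset `λ` of positive integers. -/
noncomputable def partMonomial (l : Multiset ℕ) : MvPolynomial ℕ ℚ :=
  (l.map MvPolynomial.X).prod

lemma partMonomial_eq_monomial (l : Multiset ℕ) :
    partMonomial l = MvPolynomial.monomial (Multiset.toFinsupp l) 1 := by
  induction l using Multiset.induction with
  | empty => simp [partMonomial]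
  | cons a l ih =>
    rw [partMonomial, Multiset.map_cons, Multiset.prod_cons, ← partMonomial, ih,
      ← Multiset.singleton_add, map_add, Multiset.toFinsupp_singleton, MvPolynomial.X,
      MvPolynomial.monomial_mul, mul_one]

lemma coeff_partMonomial (l m : Multiset ℕ) :
    (partMonomial l).coeff (Multiset.toFinsupp m) = if m = l then 1 else 0 := by
  rw [partMonomial_eq_monomial, MvPolynomial.coeff_monomial]
  simp [eq_comm]

/-- The generating function of all edge subsets, with the number of removed edges recorded by the
polynomial variable. -/
noncomputable def cutPolynomial {V : Type} [Fintype V] (G : SimpleGraph V) :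
    (MvPolynomial ℕ ℚ)[X] :=
  ∑ A ∈ G.edgeFinset.powerset, X ^ A.card * C (partMonomial (componentSizes (G.deleteEdges ↑A)))

lemma count_UkPoly {V : Type} [Fintype V] (G : SimpleGraph V) (k : ℕ) (m : Multiset ℕ) :
    ((UkPoly G k).count m : ℚ) =
      ∑ j ∈ Finset.range (k + 1),
        ((cutPolynomial G).coeff j).coeff (Multiset.toFinsupp m) := by
  have hcoeff : ∀ j, ((cutPolynomial G).coeff j).coeff (Multiset.toFinsupp m) =
      ∑ A ∈ G.edgeFinset.powerset, if j = A.card then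
        (if m = componentSizes (G.deleteEdges ↑A) then (1 : ℚ) else 0) else 0 := by
    intro j
    rw [cutPolynomial, finsetSum_coeff, MvPolynomial.coeff_sum]
    refine Finset.sum_congr rfl fun A _ => ?_
    rw [mul_comm, coeff_C_mul, coeff_X_pow]
    split_ifs with h1 h2 <;> simp [coeff_partMonomial, *]
  simp only [hcoeff]
  rw [Finset.sum_comm]
  simp only [Finset.sum_ite_eq', Finset.mem_range, Nat.lt_succ_iff]
  rw [UkPoly, Multiset.count_map, ← Finset.sum_filter, ← Finset.sum_filter, Finset.sum_const,
    nsmul_eq_mul, mul_one]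
  simp only [Multiset.bind_def, Multiset.pure_def, Multiset.bind_singleton, Multiset.filter_map,
    Multiset.card_map]
  rfl

/-- Cut polynomials that agree modulo `X ^ (k + 1)` give equal `U_k`-polynomials. -/
lemma UkPoly_eq_of_dvd {V V' : Type} [Fintype V] [Fintype V'] {G : SimpleGraph V}
    {G' : SimpleGraph V'} {k : ℕ} (h : X ^ (k + 1) ∣ cutPolynomial G - cutPolynomial G') :
    UkPoly G k = UkPoly G' k := by
  ext m
  rw [← Nat.cast_inj (R := ℚ), count_UkPoly, count_UkPoly]
  refine Finset.sum_congr rfl fun j hj => ?_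
  have := X_pow_dvd_iff.1 h j (Finset.mem_range.1 hj)
  rw [coeff_sub, sub_eq_zero] at this
  rw [this]

/-- The linear functional sending `z ^ m` to `x m`. -/
noncomputable def closeComponent {R : Type} [CommRing R] (x : ℕ → R) : R[X] →ₗ[R] R :=
  (Polynomial.basisMonomials R).constr ℕ x

lemma closeComponent_X_pow {R : Type} [CommRing R] (x : ℕ → R) (m : ℕ) :
    closeComponent x (X ^ m) = x m := by
  have h := (Polynomial.basisMonomials R).constr_basis ℕ x m
  rw [Polynomial.coe_basisMonomials] at h
  rw [X_pow_eq_monomial]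
  exact h

/-- The cut polynomial of a rooted tree is computed by the branching recursion. -/
theorem ParentTree.Represents.cutPolynomial_eq {V : Type} [Fintype V] {T : ParentTree V}
    {G : SimpleGraph V} (hG : T.Represents G) {A : Type} [CommRing A]
    [Algebra (MvPolynomial ℕ ℚ)[X] A] (φ : A →ₗ[(MvPolynomial ℕ ℚ)[X]] (MvPolynomial ℕ ℚ)[X])
    (z : A) (hφ : ∀ m, φ (z ^ m) = C (MvPolynomial.X m)) {W : V → A}
    (hW : ∀ v, W v = z * ∏ u with u ≠ T.root ∧ T.par u = v,
      (W u + algebraMap _ _ (X * φ (W u)))) :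
    cutPolynomial G = φ (W T.root) := by
  rw [← T.sum_cuts φ z X W hW, cutPolynomial, hG.edgeFinset]
  have hroot : ∀ B ∈ (Finset.univ.erase T.root).powerset, T.root ∉ B := fun B hB h => by
    simpa using Finset.mem_powerset.1 hB h
  have hinj : Set.InjOn T.parentEdge ↑(Finset.univ.erase T.root) := fun u hu v hv h =>
    T.parentEdge_inj (by simpa using hu) (by simpa using hv) h
  symm
  refine Finset.sum_bij (fun B _ => B.image T.parentEdge) ?_ ?_ ?_ ?_
  · intro B hB
    exact Finset.mem_powerset.2 (Finset.image_subset_image (Finset.mem_powerset.1 hB))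
  · intro B hB B' hB' h
    refine Finset.coe_injective ((hinj.image_eq_image_iff
      (Finset.coe_subset.2 (Finset.mem_powerset.1 hB))
      (Finset.coe_subset.2 (Finset.mem_powerset.1 hB'))).1 ?_)
    simpa using congrArg (fun s : Finset (Sym2 V) => (s : Set (Sym2 V))) h
  · intro A hA
    obtain ⟨B, hB, rfl⟩ := Finset.subset_image_iff.1 (Finset.mem_powerset.1 hA)
    exact ⟨B, Finset.mem_powerset.2 (Finset.coe_subset.1 hB), rfl⟩
  · intro B hB
    rw [hG.componentSizes_deleteEdges (hroot B hB), Finset.card_image_of_injOn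
      (hinj.mono (Finset.coe_subset.2 (Finset.mem_powerset.1 hB)))]
    simp only [hφ, partMonomial, Multiset.map_map, Function.comp_def]
    rw [← map_prod]
    rfl

end EdgeCuts

section PathStarTree

variable {n : ℕ} {p s : Fin n → ℕ}

/-- The parent of a vertex of `T(p,s)` rooted at the centre. -/
def parent : Vtx n p s → Vtx n p s
  | Sum.inl () => Sum.inl ()
  | Sum.inr (Sum.inl _) => Sum.inl ()
  | Sum.inr (Sum.inr (Sum.inl ⟨i, _, 0⟩)) => Sum.inr (Sum.inl i)
  | Sum.inr (Sum.inr (Sum.inl ⟨i, j, 1⟩)) => Sum.inr (Sum.inr (Sum.inl ⟨i, j, 0⟩))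
  | Sum.inr (Sum.inr (Sum.inl ⟨i, j, 2⟩)) => Sum.inr (Sum.inr (Sum.inl ⟨i, j, 1⟩))
  | Sum.inr (Sum.inr (Sum.inr ⟨i, _, 0⟩)) => Sum.inr (Sum.inl i)
  | Sum.inr (Sum.inr (Sum.inr ⟨i, j, 1⟩)) => Sum.inr (Sum.inr (Sum.inr ⟨i, j, 0⟩))
  | Sum.inr (Sum.inr (Sum.inr ⟨i, j, 2⟩)) => Sum.inr (Sum.inr (Sum.inr ⟨i, j, 0⟩))

/-- A rank on the vertices of `T(p,s)` that decreases towards the centre. -/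
def vertexRank : Vtx n p s → ℕ
  | Sum.inl () => 0
  | Sum.inr (Sum.inl _) => 1
  | Sum.inr (Sum.inr (Sum.inl ⟨_, _, l⟩)) => 2 + l
  | Sum.inr (Sum.inr (Sum.inr ⟨_, _, l⟩)) => 2 + l

/-- The tree `T(p,s)` rooted at its centre. -/
def rootedTps (n : ℕ) (p s : Fin n → ℕ) : ParentTree (Vtx n p s) where
  root := Sum.inl ()
  par := parent
  rank := vertexRank
  rank_par_lt := by
    rintro (⟨⟩ | i | ⟨i, j, l⟩ | ⟨i, j, l⟩) h
    · exact absurd rfl h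
    · simp [parent, vertexRank]
    · fin_cases l <;> simp [parent, vertexRank]
    · fin_cases l <;> simp [parent, vertexRank]

lemma TRel_iff (u v : Vtx n p s) : TRel n p s u v ↔ v ≠ Sum.inl () ∧ parent v = u := by
  constructor
  · rintro (⟨i⟩ | ⟨i, j⟩ | ⟨i, j, l⟩ | ⟨i, j⟩ | ⟨i, j, l⟩)
    · exact ⟨by simp, rfl⟩
    · exact ⟨by simp, rfl⟩
    · fin_cases l <;> exact ⟨by simp, rfl⟩
    · exact ⟨by simp, rfl⟩
    · fin_cases l <;> exact ⟨by simp, rfl⟩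
  · rintro ⟨h, rfl⟩
    rcases v with ⟨⟩ | i | ⟨i, j, l⟩ | ⟨i, j, l⟩
    · exact absurd rfl h
    · exact TRel.core i
    · fin_cases l
      · exact TRel.pathRoot i j
      · exact TRel.pathEdge i j 0
      · exact TRel.pathEdge i j 1
    · fin_cases l
      · exact TRel.starRoot i j
      · exact TRel.starEdge i j 0
      · exact TRel.starEdge i j 1

lemma rootedTps_represents (n : ℕ) (p s : Fin n → ℕ) :
    (rootedTps n p s).Represents (TpsGraph n p s) := by
  intro u v
  rw [TpsGraph, SimpleGraph.fromRel_adj, TRel_iff, TRel_iff, or_comm]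
  refine and_iff_right_of_imp ?_
  rintro h rfl
  have h' : u ≠ Sum.inl () ∧ parent u = u := by tauto
  have := (rootedTps n p s).rank_par_lt u h'.1
  exact absurd (congrArg vertexRank h'.2) this.ne

section Weights

variable {R A : Type} [CommRing R] [CommRing A] [Algebra R A] (φ : A →ₗ[R] R) (z : A) (t : R)

/-- A subtree of weight `w` is either kept or cut off. -/
def keepOrCut (w : A) : A := w + algebraMap R A (t * φ w)

/-- The weight of the subtree below a vertex of a path gadget. -/
def pathWeight : Fin 3 → A
  | 0 => z * keepOrCut φ t (z * keepOrCut φ t z)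
  | 1 => z * keepOrCut φ t z
  | 2 => z

/-- The weight of the subtree below a vertex of a star gadget. -/
def starWeight : Fin 3 → A
  | 0 => z * (keepOrCut φ t z * keepOrCut φ t z)
  | 1 => z
  | 2 => z

/-- The weight of the branch at a root with `a` path gadgets and `b` star gadgets. -/
def branchWeight (a b : ℕ) : A :=
  z * (keepOrCut φ t (pathWeight φ z t 0) ^ a * keepOrCut φ t (starWeight φ z t 0) ^ b)

/-- The weight of the subtree below a vertex of `T(p,s)`. -/
noncomputable def vertexWeight : Vtx n p s → A
  | Sum.inl () => z * ∏ i, keepOrCut φ t (branchWeight φ z t (p i) (s i))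
  | Sum.inr (Sum.inl i) => branchWeight φ z t (p i) (s i)
  | Sum.inr (Sum.inr (Sum.inl ⟨_, _, l⟩)) => pathWeight φ z t l
  | Sum.inr (Sum.inr (Sum.inr ⟨_, _, l⟩)) => starWeight φ z t l

lemma prod_children (f : Vtx n p s → A) (v : Vtx n p s) :
    ∏ u with u ≠ (rootedTps n p s).root ∧ (rootedTps n p s).par u = v, f u =
      (∏ i : Fin n, if (Sum.inl () : Vtx n p s) = v then f (Sum.inr (Sum.inl i)) else 1) *
      ((∏ i : Fin n, ∏ j : Fin (p i), ∏ l : Fin 3,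
        if parent (Sum.inr (Sum.inr (Sum.inl ⟨i, j, l⟩)) : Vtx n p s) = v then
          f (Sum.inr (Sum.inr (Sum.inl ⟨i, j, l⟩))) else 1) *
      (∏ i : Fin n, ∏ j : Fin (s i), ∏ l : Fin 3,
        if parent (Sum.inr (Sum.inr (Sum.inr ⟨i, j, l⟩)) : Vtx n p s) = v then
          f (Sum.inr (Sum.inr (Sum.inr ⟨i, j, l⟩))) else 1)) := by
  rw [Finset.prod_filter, Fintype.prod_sum_type, Fintype.prod_sum_type, Fintype.prod_sum_type,
    Fintype.prod_sigma, Fintype.prod_sigma]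
  have hpar : ∀ i, parent (Sum.inr (Sum.inl i) : Vtx n p s) = Sum.inl () := fun _ => rfl
  simp [Fintype.prod_prod_type, rootedTps, hpar]

lemma vertexWeight_eq (v : Vtx n p s) :
    vertexWeight φ z t v = z * ∏ u with u ≠ (rootedTps n p s).root ∧ (rootedTps n p s).par u = v,
      (vertexWeight φ z t u + algebraMap R A (t * φ (vertexWeight φ z t u))) := by
  rw [prod_children]
  have hgadget : ∀ (q : Fin n → ℕ) (i i' : Fin n) (j : Fin (q i)) (j' : Fin (q i'))
      (l l' : Fin 3), (⟨i', j', l'⟩ : Σ i, Fin (q i) × Fin 3) = ⟨i, j, l⟩ ↔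
        (⟨i', j'⟩ : Σ i, Fin (q i)) = ⟨i, j⟩ ∧ l' = l := by
    intro q i i' j j' l l'
    constructor
    · rintro h
      cases h
      exact ⟨rfl, rfl⟩
    · rintro ⟨h, rfl⟩
      cases h
      rfl
  have hpath : ∀ (q : Fin n → ℕ) (i : Fin n) (j : Fin (q i)) (c : A),
      ∏ i' : Fin n, ∏ j' : Fin (q i'),
        (if (⟨i', j'⟩ : Σ i, Fin (q i)) = ⟨i, j⟩ then c else 1) = c := by
    intro q i j c
    rw [← Fintype.prod_sigma' fun i' (j' : Fin (q i')) =>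
      if (⟨i', j'⟩ : Σ i, Fin (q i)) = ⟨i, j⟩ then c else 1]
    simp
  rcases v with ⟨⟩ | i | ⟨i, j, l⟩ | ⟨i, j, l⟩
  · simp [Fin.prod_univ_three, parent, vertexWeight, keepOrCut]
  · simp [Fin.prod_univ_three, parent, vertexWeight, keepOrCut, branchWeight]
  · fin_cases l <;>
      simp [Fin.prod_univ_three, parent, vertexWeight, keepOrCut, pathWeight, hpath, hgadget,
        -Sigma.mk.injEq, -mul_ite, -ite_mul]
  · fin_cases l <;>
      simp [Fin.prod_univ_three, parent, vertexWeight, keepOrCut, starWeight, hpath, hgadget,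
        Finset.prod_mul_distrib, -Sigma.mk.injEq, -mul_ite, -ite_mul]

end Weights

end PathStarTree

section Gadgets

variable {R A : Type} [CommRing R] [CommRing A] [Algebra R A] (φ : A →ₗ[R] R)

lemma exists_pathWeight_eq_starWeight_add (z : A) (t : R) :
    ∃ d, keepOrCut φ t (pathWeight φ z t 0) =
      keepOrCut φ t (starWeight φ z t 0) + algebraMap R A t * d := by
  refine ⟨z * algebraMap R A (φ (z * keepOrCut φ t z)) -
    z * keepOrCut φ t z * algebraMap R A (φ z) +
    algebraMap R A (φ (pathWeight φ z t 0) - φ (starWeight φ z t 0)), ?_⟩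
  simp only [keepOrCut, pathWeight, starWeight, map_mul, map_sub]
  ring

lemma dvd_keepOrCut_iff (t : R) (w : A) :
    algebraMap R A t ∣ keepOrCut φ t w ↔ algebraMap R A t ∣ w := by
  rw [keepOrCut, map_mul]
  exact dvd_add_left (dvd_mul_right _ _)

end Gadgets

open Polynomial in
lemma X_pow_dvd_cutPolynomial_sub {A : Type} [CommRing A] [IsDomain A] [Algebra ℚ A]
    [Algebra (MvPolynomial ℕ ℚ)[X] A] (φ : A →ₗ[(MvPolynomial ℕ ℚ)[X]] (MvPolynomial ℕ ℚ)[X])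
    (z : A) (hφ : ∀ m, φ (z ^ m) = C (MvPolynomial.X m))
    (hprime : Prime (algebraMap (MvPolynomial ℕ ℚ)[X] A X))
    (hz : ¬ algebraMap (MvPolynomial ℕ ℚ)[X] A X ∣ z) {k α n : ℕ} (hk : 0 < k)
    {p p' : Fin n → ℕ} (hp : ∀ i, p i ≤ α) (hp' : ∀ i, p' i ≤ α) (hpte : PTErel k p p') :
    X ^ (k + 2) ∣ cutPolynomial (Ttree α p) - cutPolynomial (Ttree α p') := by
  have hcut : ∀ q : Fin n → ℕ, cutPolynomial (Ttree α q) =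
      φ (z * ∏ i, keepOrCut φ X (branchWeight φ z X (q i) (α - q i))) := fun q =>
    (rootedTps_represents n q fun i => α - q i).cutPolynomial_eq φ z hφ (W := vertexWeight φ z X)
      (fun v => by convert vertexWeight_eq φ z X v)
  obtain ⟨d, hd⟩ := exists_pathWeight_eq_starWeight_add φ z X
  obtain ⟨f, hf⟩ := pow_dvd_branch_prod_sub φ z _ _ d X hd hprime
    (by simp [dvd_keepOrCut_iff, pathWeight, hprime.dvd_mul, hz])
    (by simp [dvd_keepOrCut_iff, starWeight, hprime.dvd_mul, hz]) hk hp hp' hpte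
  rw [hcut, hcut, ← map_sub, ← mul_sub]
  simp only [branchWeight]
  simp only [keepOrCut] at hf ⊢
  rw [hf, ← map_pow, mul_left_comm, ← Algebra.smul_def, map_smul, smul_eq_mul]
  exact dvd_mul_right _ _

open Polynomial in
/-- If `p =_k p'` are `α`-compatible sequences, then the trees `T_α(p)` and `T_α(p')`
have the same `U_{k+1}`-polynomial. -/
theorem same_Uk_of_PTE (k α n : ℕ) (hk : 0 < k) (hα : 0 < α)
    (p p' : Fin n → ℕ) (hp : AlphaCompatible α p) (hp' : AlphaCompatible α p')
    (hpte : PTErel k p p') :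
    UkPoly (Ttree α p) (k + 1) = UkPoly (Ttree α p') (k + 1) := by
  refine UkPoly_eq_of_dvd (X_pow_dvd_cutPolynomial_sub
    (closeComponent fun m => (C (MvPolynomial.X m) : (MvPolynomial ℕ ℚ)[X])) X
    (closeComponent_X_pow _) (prime_C_iff.2 prime_X) ?_ hk hp.2 hp'.2 hpte)
  rw [algebraMap_eq, C_dvd_iff_dvd_coeff]
  intro h
  exact prime_X.not_isUnit (isUnit_of_dvd_one (by simpa using h 1))
end

section
/- Let k and α be positive integers and let p and p' be two α-compatible sequences of non-negative integers of the same length n such that p =_k p' but Σ_{i=1}^n p_i^{k+1} ≠ Σ_{i=1}^n (p'_i)^{k+1}. Then U_{k+2}(T_α(p)) ≠ U_{k+2}(T_α(p')), i.e. the trees T_α(p) and T_α(p') have different U_{k+2}-polynomials. -/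
open scoped Classical

/-- A rooted tree structure on `V`, given by a parent map. -/
structure ParentMap (V : Type) where
  /-- the root -/
  root : V
  /-- the parent of a vertex (irrelevant at the root) -/
  par : V → V
  /-- a rank function witnessing that iterated parents reach the root -/
  depth : V → ℕ
  depth_par_lt : ∀ v, v ≠ root → depth (par v) < depth v

namespace ParentMap

variable {V : Type} (T : ParentMap V)

theorem par_ne_self {v : V} (h : v ≠ T.root) : T.par v ≠ v := fun e => by
  have := T.depth_par_lt v h
  rw [e] at this
  exact lt_irrefl _ this

/-- The edge joining a vertex to its parent. -/
def edge (v : V) : Sym2 V := s(v, T.par v)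

theorem edge_injOn : Set.InjOn T.edge {v | v ≠ T.root} := by
  intro v hv w hw h
  rcases Sym2.eq_iff.1 h with ⟨h, -⟩ | ⟨h₁, h₂⟩
  · exact h
  · have a := T.depth_par_lt v hv
    have b := T.depth_par_lt w hw
    rw [h₂] at a
    rw [← h₁] at b
    exact absurd (a.trans b) (lt_irrefl _)

/-- `T` is a rooting of the tree `G`. -/
def IsRootingOf (G : SimpleGraph V) : Prop :=
  ∀ u v, G.Adj u v ↔ (u ≠ T.root ∧ T.par u = v) ∨ (v ≠ T.root ∧ T.par v = u)

variable {T} in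
theorem IsRootingOf.mem_edgeSet {G : SimpleGraph V} (hG : T.IsRootingOf G) (e : Sym2 V) :
    e ∈ G.edgeSet ↔ ∃ v, v ≠ T.root ∧ T.edge v = e := by
  induction e with
  | _ u v =>
    rw [SimpleGraph.mem_edgeSet, hG]
    constructor
    · rintro (⟨h, rfl⟩ | ⟨h, rfl⟩)
      · exact ⟨u, h, rfl⟩
      · exact ⟨v, h, Sym2.eq_swap⟩
    · rintro ⟨w, h, e⟩
      rcases Sym2.eq_iff.1 e with ⟨rfl, h'⟩ | ⟨rfl, h'⟩
      · exact Or.inl ⟨h, h'⟩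
      · exact Or.inr ⟨h, h'⟩

variable [DecidableEq V]

/-- The top vertex of the component of `v` after cutting each vertex of `S` off its parent. -/
def top (S : Finset V) (v : V) : V :=
  if _h : v ∈ insert T.root S then v else top S (T.par v)
termination_by T.depth v
decreasing_by exact T.depth_par_lt v fun hv => _h (by simp [hv])

theorem top_of_mem {S : Finset V} {v : V} (h : v ∈ insert T.root S) : T.top S v = v := by
  rw [top, dif_pos h]

theorem top_of_notMem {S : Finset V} {v : V} (h : v ∉ insert T.root S) :
    T.top S v = T.top S (T.par v) := by
  rw [top, dif_neg h]

theorem top_induction {S : Finset V} {P : V → Prop}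
    (hpar : ∀ v, P v → v ∉ insert T.root S → P (T.par v)) (v : V) (hv : P v) :
    P (T.top S v) := by
  induction hd : T.depth v using Nat.strong_induction_on generalizing v with
  | _ d ih =>
    by_cases h : v ∈ insert T.root S
    · rwa [T.top_of_mem h]
    · rw [T.top_of_notMem h]
      exact ih _ (hd ▸ T.depth_par_lt v fun e => h (by simp [e])) _ (hpar v hv h) rfl

theorem top_mem (S : Finset V) (v : V) : T.top S v ∈ insert T.root S := by
  induction hd : T.depth v using Nat.strong_induction_on generalizing v with
  | _ d ih =>
    by_cases h : v ∈ insert T.root S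
    · rwa [T.top_of_mem h]
    · rw [T.top_of_notMem h]
      exact ih _ (hd ▸ T.depth_par_lt v fun e => h (by simp [e])) _ rfl

variable {T} {G : SimpleGraph V}

theorem IsRootingOf.reachable_iff (hG : T.IsRootingOf G) {S : Finset V} (hS : T.root ∉ S)
    (u v : V) : (G.deleteEdges ↑(S.image T.edge)).Reachable u v ↔ T.top S u = T.top S v := by
  have hpar : ∀ w, w ∉ insert T.root S →
      (G.deleteEdges ↑(S.image T.edge)).Adj w (T.par w) := by
    intro w hw
    have hr : w ≠ T.root := fun e => hw (by simp [e])
    refine SimpleGraph.deleteEdges_adj.2 ⟨(hG _ _).2 (Or.inl ⟨hr, rfl⟩), ?_⟩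
    intro h
    obtain ⟨x, hx, e⟩ := Finset.mem_image.1 (Finset.mem_coe.1 h)
    have hxr : x ≠ T.root := fun e => hS (e ▸ hx)
    exact hw (Finset.mem_insert_of_mem (T.edge_injOn hxr hr e ▸ hx))
  have htop : ∀ w, (G.deleteEdges ↑(S.image T.edge)).Reachable w (T.top S w) := fun w =>
    T.top_induction (P := (G.deleteEdges ↑(S.image T.edge)).Reachable w)
      (fun x hx hn => hx.trans (hpar x hn).reachable) w (SimpleGraph.Reachable.refl w)
  constructor
  · rintro ⟨p⟩
    induction p with
    | nil => rfl
    | @cons a b c h _ ih =>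
      rw [← ih]
      obtain ⟨h, hn⟩ := SimpleGraph.deleteEdges_adj.1 h
      have key : ∀ x, x ≠ T.root → T.edge x ∉ (↑(S.image T.edge) : Set (Sym2 V)) →
          T.top S x = T.top S (T.par x) := fun x hx hn => T.top_of_notMem fun hm => by
        rcases Finset.mem_insert.1 hm with hm | hm
        · exact hx hm
        · exact hn (Finset.mem_coe.2 (Finset.mem_image_of_mem _ hm))
      rcases (hG _ _).1 h with ⟨hr, rfl⟩ | ⟨hr, rfl⟩
      · exact key _ hr hn
      · exact (key _ hr (by rwa [edge, Sym2.eq_swap])).symm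
  · intro h
    exact (htop u).trans (h ▸ (htop v).symm)

variable [Fintype V]

variable (T) in
/-- The number of vertices in the component with top vertex `s`. -/
def size (S : Finset V) (s : V) : ℕ := (Finset.univ.filter fun v => T.top S v = s).card

theorem IsRootingOf.componentSizes_eq (hG : T.IsRootingOf G) {S : Finset V}
    (hS : T.root ∉ S) : componentSizes (G.deleteEdges ↑(S.image T.edge)) =
      (insert T.root S).val.map (T.size S) := by
  set H := G.deleteEdges ↑(S.image T.edge) with hH
  have himg : ∀ inst : Fintype H.ConnectedComponent,
      (Finset.univ : Finset H.ConnectedComponent) =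
      (insert T.root S).image H.connectedComponentMk := by
    intro inst
    ext c
    induction c using SimpleGraph.ConnectedComponent.ind with
    | _ v =>
      simp only [Finset.mem_univ, true_iff]
      refine Finset.mem_image.2 ⟨T.top S v, T.top_mem S v, ?_⟩
      rw [SimpleGraph.ConnectedComponent.eq, hG.reachable_iff hS, T.top_of_mem (T.top_mem S v)]
  rw [componentSizes, himg, Finset.image_val_of_injOn, Multiset.map_map]
  · refine Multiset.map_congr rfl fun s hs => ?_
    refine Nat.subtype_card _ fun v => ?_
    rw [SimpleGraph.ConnectedComponent.mem_supp_iff, SimpleGraph.ConnectedComponent.eq,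
      hG.reachable_iff hS, T.top_of_mem hs]
    simp
  · intro x hx y hy h
    rw [SimpleGraph.ConnectedComponent.eq, hG.reachable_iff hS, T.top_of_mem hx,
      T.top_of_mem hy] at h
    exact h

theorem sum_size (S : Finset V) : ∑ s ∈ insert T.root S, T.size S s = Fintype.card V :=
  (Finset.card_eq_sum_card_fiberwise fun v _ => T.top_mem S v).symm

theorem IsRootingOf.count_UkPoly (hG : T.IsRootingOf G) (k : ℕ) (m : Multiset ℕ) 
    (hm : m.card = k + 1) : (UkPoly G k).count m =
      (Finset.univ.filter fun S : Finset V =>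
        T.root ∉ S ∧ (insert T.root S).val.map (T.size S) = m).card := by
  have hU : UkPoly G k = (G.edgeFinset.powerset.filter fun A => A.card ≤ k).val.map
      fun A : Finset (Sym2 V) => componentSizes (G.deleteEdges ↑A) := by
    simp [UkPoly, Multiset.bind_def, Multiset.pure_def]
  rw [hU, Multiset.count_map, ← Finset.filter_val, Finset.card_val]
  symm
  refine Finset.card_bij (fun S _ => S.image T.edge) ?_ ?_ ?_
  · intro S hS
    obtain ⟨hr, hS⟩ := (Finset.mem_filter.1 hS).2
    simp only [Finset.mem_filter, Finset.mem_powerset]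
    have hc : S.card = k := by
      have := congrArg Multiset.card hS
      rw [Multiset.card_map, Finset.card_val, Finset.card_insert_of_notMem hr, hm] at this
      omega
    refine ⟨⟨fun e he => ?_, ?_⟩, ?_⟩
    · obtain ⟨v, hv, rfl⟩ := Finset.mem_image.1 he
      exact SimpleGraph.mem_edgeFinset.2 ((hG.mem_edgeSet _).2 ⟨v, fun e => hr (e ▸ hv), rfl⟩)
    · exact Finset.card_image_le.trans hc.le
    · rw [← hS]
      convert (hG.componentSizes_eq hr).symm
  · intro S hS S' hS' h
    obtain ⟨hr, -⟩ := (Finset.mem_filter.1 hS).2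
    obtain ⟨hr', -⟩ := (Finset.mem_filter.1 hS').2
    have h2 : (S : Set V) = S' := by
      refine (T.edge_injOn.image_eq_image_iff (fun v hv e => hr ?_) (fun v hv e => hr' ?_)).1 ?_
      · exact e ▸ hv
      · exact e ▸ hv
      · rw [← Finset.coe_image, ← Finset.coe_image, h]
    exact_mod_cast h2
  · intro A hA
    obtain ⟨⟨hA, -⟩, hm⟩ := by simpa only [Finset.mem_filter, Finset.mem_powerset] using hA
    have hsub : A ⊆ (Finset.univ.erase T.root).image T.edge := fun e he => by
      obtain ⟨v, hv, rfl⟩ := (hG.mem_edgeSet e).1 (SimpleGraph.mem_edgeFinset.1 (hA he))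
      exact Finset.mem_image_of_mem _ (by simp [hv])
    obtain ⟨S, hS, rfl⟩ := Finset.subset_image_iff.1 hsub
    have hr : T.root ∉ S := fun h => by simpa using hS h
    refine ⟨S, Finset.mem_filter.2 ⟨Finset.mem_univ _, hr, ?_⟩, rfl⟩
    rw [← hG.componentSizes_eq hr, hm]

theorem size_eq_one_iff {S : Finset V} {s : V} (hs : s ∈ S) :
    T.size S s = 1 ↔ ∀ v, v ≠ T.root → T.par v = s → v ∈ S := by
  have hself : T.top S s = s := T.top_of_mem (Finset.mem_insert_of_mem hs)
  rw [size, Finset.card_eq_one]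
  constructor
  · rintro ⟨x, hx⟩ v hv rfl
    by_contra hvS
    have key : ∀ w, T.top S w = T.par v → w = x := fun w hw => by
      have : w ∈ Finset.univ.filter fun u => T.top S u = T.par v := by simp [hw]
      simpa [hx] using this
    have h1 := key v (by rw [T.top_of_notMem (by simp [hv, hvS]), hself])
    exact T.par_ne_self hv ((key _ hself).trans h1.symm)
  · intro h
    refine ⟨s, Finset.ext fun v => ?_⟩
    simp only [Finset.mem_filter, Finset.mem_univ, true_and, Finset.mem_singleton]
    refine ⟨fun hv => ?_, fun hv => hv ▸ hself⟩
    by_contra hne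
    refine T.top_induction (P := fun u => u ≠ s) (fun u _ hu e => hu ?_) v hne hv
    exact Finset.mem_insert_of_mem (h u (fun e => hu (by simp [e])) e)

end ParentMap

namespace PTETree

variable {n : ℕ} {p s : Fin n → ℕ}

/-- The vertices hanging below `v_i`, indexed by a path or star copy and a position in it. -/
abbrev Pendant (p s : Fin n → ℕ) (i : Fin n) : Type := (Fin (p i) ⊕ Fin (s i)) × Fin 3

/-- The central vertex. -/
abbrev center : Vtx n p s := Sum.inl ()

/-- The root `v_i` of the `i`-th branch. -/
abbrev branchRoot (i : Fin n) : Vtx n p s := Sum.inr (Sum.inl i)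

/-- A vertex hanging below `v_i`, as a vertex of the whole tree. -/
def pendant (i : Fin n) : Pendant p s i ↪ Vtx n p s where
  toFun
    | (Sum.inl j, l) => Sum.inr (Sum.inr (Sum.inl ⟨i, j, l⟩))
    | (Sum.inr j, l) => Sum.inr (Sum.inr (Sum.inr ⟨i, j, l⟩))
  inj' := by
    rintro ⟨j | j, l⟩ ⟨j' | j', l'⟩ h <;> simp_all

theorem pendant_inl (i : Fin n) (j : Fin (p i)) (l : Fin 3) :
    (pendant i (Sum.inl j, l) : Vtx n p s) = Sum.inr (Sum.inr (Sum.inl ⟨i, j, l⟩)) := rfl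

theorem pendant_inr (i : Fin n) (j : Fin (s i)) (l : Fin 3) :
    (pendant i (Sum.inr j, l) : Vtx n p s) = Sum.inr (Sum.inr (Sum.inr ⟨i, j, l⟩)) := rfl

/-- The parent of a vertex of `T(p,s)`, rooted at its center. -/
def parent : Vtx n p s → Vtx n p s
  | Sum.inl _ => center
  | Sum.inr (Sum.inl _) => center
  | Sum.inr (Sum.inr (Sum.inl ⟨i, j, l⟩)) =>
    if l = 0 then branchRoot i else Sum.inr (Sum.inr (Sum.inl ⟨i, j, l - 1⟩))
  | Sum.inr (Sum.inr (Sum.inr ⟨i, j, l⟩)) =>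
    if l = 0 then branchRoot i else Sum.inr (Sum.inr (Sum.inr ⟨i, j, 0⟩))

/-- The distance of a vertex of `T(p,s)` from the center. -/
def level : Vtx n p s → ℕ
  | Sum.inl _ => 0
  | Sum.inr (Sum.inl _) => 1
  | Sum.inr (Sum.inr (Sum.inl ⟨_, _, l⟩)) => 2 + l
  | Sum.inr (Sum.inr (Sum.inr ⟨_, _, l⟩)) => if l = 0 then 2 else 3

/-- The tree `T(p,s)` rooted at its center. -/
def rooting (p s : Fin n → ℕ) : ParentMap (Vtx n p s) where
  root := center
  par := parent
  depth := level
  depth_par_lt := by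
    rintro (_ | i | ⟨i, j, l⟩ | ⟨i, j, l⟩) h
    · exact absurd rfl h
    · simp [parent, level]
    · fin_cases l <;> simp [parent, level]
    · fin_cases l <;> simp [parent, level]

theorem rooting_isRootingOf : (rooting p s).IsRootingOf (TpsGraph n p s) := by
  have h1 : ∀ u v, TRel n p s u v → v ≠ center ∧ parent v = u := by
    rintro _ _ (i | ⟨i, j⟩ | ⟨i, j, l⟩ | ⟨i, j⟩ | ⟨i, j, l⟩)
    · simp [parent]
    · simp [parent]
    · fin_cases l <;> simp [parent]
    · simp [parent]
    · fin_cases l <;> simp [parent]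
  have h2 : ∀ v : Vtx n p s, v ≠ center → TRel n p s (parent v) v := by
    rintro (_ | i | ⟨i, j, l⟩ | ⟨i, j, l⟩) h
    · exact absurd rfl h
    · exact TRel.core i
    · fin_cases l
      · exact TRel.pathRoot i j
      · exact TRel.pathEdge i j 0
      · exact TRel.pathEdge i j 1
    · fin_cases l
      · exact TRel.starRoot i j
      · exact TRel.starEdge i j 0
      · exact TRel.starEdge i j 1
  have h3 : ∀ u v, TRel n p s u v ↔ v ≠ center ∧ parent v = u := fun u v =>
    ⟨h1 u v, fun ⟨hv, e⟩ => e ▸ h2 v hv⟩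
  intro u v
  rw [TpsGraph, SimpleGraph.fromRel_adj, h3, h3]
  constructor
  · rintro ⟨-, h⟩
    exact h.symm
  · intro h
    refine ⟨?_, h.symm⟩
    rintro rfl
    rcases h with ⟨h, e⟩ | ⟨h, e⟩ <;> exact (rooting p s).par_ne_self h e

/-- The branch containing a vertex. -/
def branch : Vtx n p s → Option (Fin n)
  | Sum.inl _ => none
  | Sum.inr (Sum.inl i) => some i
  | Sum.inr (Sum.inr (Sum.inl ⟨i, _⟩)) => some i
  | Sum.inr (Sum.inr (Sum.inr ⟨i, _⟩)) => some i

theorem branch_eq_some_iff (v : Vtx n p s) (i : Fin n) :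
    branch v = some i ↔ v = branchRoot i ∨ ∃ x, pendant i x = v := by
  constructor
  · rcases v with _ | i' | ⟨i', j, l⟩ | ⟨i', j, l⟩ <;> intro h
    · cases h
    · cases h
      exact Or.inl rfl
    · cases h
      exact Or.inr ⟨(Sum.inl j, l), rfl⟩
    · cases h
      exact Or.inr ⟨(Sum.inr j, l), rfl⟩
  · rintro (rfl | ⟨⟨j | j, l⟩, rfl⟩) <;> rfl

theorem vertex_cases (v : Vtx n p s) :
    v = center ∨ (∃ i, v = branchRoot i) ∨ ∃ i x, v = pendant i x := by
  rcases v with _ | i | ⟨i, j, l⟩ | ⟨i, j, l⟩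
  · exact Or.inl rfl
  · exact Or.inr (Or.inl ⟨i, rfl⟩)
  · exact Or.inr (Or.inr ⟨i, (Sum.inl j, l), rfl⟩)
  · exact Or.inr (Or.inr ⟨i, (Sum.inr j, l), rfl⟩)

theorem pendant_ne_center (i : Fin n) (x : Pendant p s i) : pendant i x ≠ center := by
  rcases x with ⟨j | j, l⟩ <;> simp [pendant_inl, pendant_inr]

theorem pendant_ne_branchRoot (i i' : Fin n) (x : Pendant p s i) :
    pendant i x ≠ branchRoot i' := by
  rcases x with ⟨j | j, l⟩ <;> simp [pendant_inl, pendant_inr]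

theorem branch_parent_of_ne {v : Vtx n p s} {i : Fin n} (h : branch v = some i)
    (hv : v ≠ branchRoot i) : branch (parent v) = some i := by
  rcases (branch_eq_some_iff v i).1 h with rfl | ⟨⟨j | j, l⟩, rfl⟩
  · exact absurd rfl hv
  · fin_cases l <;> simp [pendant_inl, parent, branch]
  · fin_cases l <;> simp [pendant_inr, parent, branch]

theorem branch_of_branch_parent {v : Vtx n p s} {i : Fin n} (h : branch (parent v) = some i) :
    branch v = some i := by
  rcases v with _ | i' | ⟨i', j, l⟩ | ⟨i', j, l⟩
  · cases h
  · cases h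
  · fin_cases l <;> simpa [parent, branch] using h
  · fin_cases l <;> simpa [parent, branch] using h

/-- `IsChild j l l'` says that position `l'` is a child of position `l` in the copy `j` of a path
or star. -/
def IsChild {a b : ℕ} : Fin a ⊕ Fin b → Fin 3 → Fin 3 → Prop
  | Sum.inl _, l, l' => l' ≠ 0 ∧ l' - 1 = l
  | Sum.inr _, l, l' => l' ≠ 0 ∧ l = 0

theorem parent_eq_pendant_iff (v : Vtx n p s) (i : Fin n) (j : Fin (p i) ⊕ Fin (s i))
    (l : Fin 3) :
    parent v = pendant i (j, l) ↔ ∃ l', v = pendant i (j, l') ∧ IsChild j l l' := by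
  constructor
  · intro h
    have hb : branch (parent v) = some i := (branch_eq_some_iff _ i).2 (Or.inr ⟨_, h.symm⟩)
    rcases (branch_eq_some_iff v i).1 (branch_of_branch_parent hb) with rfl | ⟨⟨j' | j', l'⟩, rfl⟩
    · exact absurd h.symm (pendant_ne_center _ _)
    · refine ⟨l', ?_⟩
      by_cases hl : l' = 0
      · rcases j with j | j <;> simp [pendant_inl, pendant_inr, parent, hl] at h
      · rcases j with j | j <;> simp_all [pendant_inl, pendant_inr, parent, IsChild]
    · refine ⟨l', ?_⟩
      by_cases hl : l' = 0
      · rcases j with j | j <;> simp [pendant_inl, pendant_inr, parent, hl] at h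
      · rcases j with j | j <;> simp_all [pendant_inl, pendant_inr, parent, IsChild]
  · rintro ⟨l', rfl, h⟩
    rcases j with j | j <;> simp_all [pendant_inl, pendant_inr, parent, IsChild]

theorem card_filter_branch (i : Fin n) :
    (Finset.univ.filter fun v : Vtx n p s => branch v = some i).card = (p i + s i) * 3 + 1 := by
  have : (Finset.univ.filter fun v : Vtx n p s => branch v = some i) =
      insert (branchRoot i) (Finset.univ.map (pendant i)) := by
    ext v
    simp [branch_eq_some_iff]
  rw [this, Finset.card_insert_of_notMem, Finset.card_map]
  · simp
  · simp [pendant_ne_branchRoot]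

theorem card_vertices {α : ℕ} (hs : ∀ i, p i + s i = α) :
    Fintype.card (Vtx n p s) = 1 + n * (α * 3 + 1) := by
  have : ∑ i, p i * 3 + ∑ i, s i * 3 = n * (α * 3) := by
    rw [← Finset.sum_add_distrib, Finset.sum_congr rfl fun i _ => by
      rw [← add_mul, hs i]]
    simp
  simp only [Fintype.card_sum, Fintype.card_unit, Fintype.card_fin, Fintype.card_sigma,
    Fintype.card_prod]
  rw [this]
  ring

variable {S : Finset (Vtx n p s)}

theorem size_pendant_le (i : Fin n) (x : Pendant p s i) :
    (rooting p s).size S (pendant i x) ≤ 3 := by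
  obtain ⟨j, l⟩ := x
  have hsub : (Finset.univ.filter fun v => (rooting p s).top S v = pendant i (j, l)) ⊆
      Finset.univ.image fun l' : Fin 3 => pendant i (j, l') := by
    intro v hv
    by_contra hn
    refine (rooting p s).top_induction (S := S) (P := fun u => ∀ l', u ≠ pendant i (j, l'))
      (fun u hu _ l' e => ?_) v (fun l' e => hn (by simp [e])) l (Finset.mem_filter.1 hv).2
    obtain ⟨l', rfl, -⟩ := (parent_eq_pendant_iff u i j l').1 e
    exact hu l' rfl
  exact (Finset.card_le_card hsub).trans (Finset.card_image_le.trans (by simp))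

theorem branch_eq_of_top {v : Vtx n p s} {i : Fin n}
    (h : branch ((rooting p s).top S v) = some i) : branch v = some i := by
  by_contra hn
  exact (rooting p s).top_induction (S := S) (P := fun u => branch u ≠ some i)
    (fun u hu _ e => hu (branch_of_branch_parent e)) v hn h

theorem size_branchRoot_le (i : Fin n) :
    (rooting p s).size S (branchRoot i) ≤ (p i + s i) * 3 + 1 := by
  rw [← card_filter_branch i]
  refine Finset.card_le_card fun v hv => ?_
  simp only [Finset.mem_filter, Finset.mem_univ, true_and] at hv ⊢
  exact branch_eq_of_top (by rw [hv]; rfl)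

theorem branch_top {v : Vtx n p s} {i : Fin n} (hi : branchRoot i ∈ S) (h : branch v = some i) :
    branch ((rooting p s).top S v) = some i :=
  (rooting p s).top_induction (P := fun u => branch u = some i)
    (fun _ hu hn => branch_parent_of_ne hu fun e => hn (Finset.mem_insert_of_mem (e ▸ hi))) v h

theorem card_filter_branch_ne {α : ℕ} (hs : ∀ i, p i + s i = α) (i : Fin n) :
    (Finset.univ.filter fun v : Vtx n p s => branch v ≠ some i).card =
      1 + (n - 1) * (α * 3 + 1) := by
  have h1 := Finset.card_filter_add_card_filter_not (s := Finset.univ)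
    (fun v : Vtx n p s => branch v = some i)
  rw [card_filter_branch, hs, Finset.card_univ, card_vertices hs] at h1
  obtain ⟨m, rfl⟩ : ∃ m, n = m + 1 := ⟨n - 1, by have := i.2; omega⟩
  simp only [Nat.add_sub_cancel]
  linarith

/-- The partition of `T(p,s)` arising from cutting off a branch with `α` copies of paths and stars
and `m` single vertices from that branch. -/
def leafCutPartition (n α m : ℕ) : Multiset ℕ :=
  (1 + (n - 1) * (α * 3 + 1)) ::ₘ (α * 3 + 1 - m) ::ₘ Multiset.replicate m 1

/-- A set of pendant vertices of a branch which is closed under taking children. -/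
def ChildClosed {a b : ℕ} (E : Finset ((Fin a ⊕ Fin b) × Fin 3)) : Prop :=
  ∀ j l, (j, l) ∈ E → ∀ l', IsChild j l l' → (j, l') ∈ E

theorem childClosed_iff (i : Fin n) (E : Finset (Pendant p s i)) :
    ChildClosed E ↔ ∀ x ∈ E,
      (rooting p s).size (insert (branchRoot i) (E.map (pendant i))) (pendant i x) = 1 := by
  have hmem : ∀ x, pendant i x ∈ insert (branchRoot i) (E.map (pendant i)) ↔ x ∈ E := fun x => by
    simp [pendant_ne_branchRoot]
  constructor
  · rintro h ⟨j, l⟩ hx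
    rw [ParentMap.size_eq_one_iff ((hmem _).2 hx)]
    intro v _ hv
    obtain ⟨l', rfl, hl⟩ := (parent_eq_pendant_iff v i j l).1 hv
    exact (hmem _).2 (h j l hx l' hl)
  · intro h j l hx l' hl
    have := h _ hx
    rw [ParentMap.size_eq_one_iff ((hmem _).2 hx)] at this
    exact (hmem _).1 (this _ (pendant_ne_center i _)
      ((parent_eq_pendant_iff _ i j l).2 ⟨l', rfl, hl⟩))

theorem sizes_of_childClosed {α m : ℕ} (hs : ∀ i, p i + s i = α) (i : Fin n)
    (E : Finset (Pendant p s i)) (hE : ChildClosed E) (hm : E.card = m) :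
    (insert center (insert (branchRoot i) (E.map (pendant i)))).val.map
      ((rooting p s).size (insert (branchRoot i) (E.map (pendant i)))) =
      leafCutPartition n α m := by
  set S := insert (branchRoot i) (E.map (pendant i)) with hS
  have hr : branchRoot i ∉ E.map (pendant i) := by simp [pendant_ne_branchRoot]
  have hc : center ∉ S := by simp [hS, pendant_ne_center]
  have hbr : ∀ v ∈ S, branch v = some i := fun v hv => by
    rw [branch_eq_some_iff]
    simp only [hS, Finset.mem_insert, Finset.mem_map] at hv
    obtain h | ⟨x, -, h⟩ := hv
    · exact Or.inl h
    · exact Or.inr ⟨x, h⟩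
  have hcenter : (rooting p s).size S center = 1 + (n - 1) * (α * 3 + 1) := by
    rw [← card_filter_branch_ne hs i, ParentMap.size]
    congr 1
    ext v
    simp only [Finset.mem_filter, Finset.mem_univ, true_and]
    constructor
    · intro h hb
      have := branch_top (S := S) (Finset.mem_insert_self _ _) hb
      rw [h] at this
      cases this
    · intro h
      rcases Finset.mem_insert.1 ((rooting p s).top_mem S v) with h' | h'
      · exact h'
      · exact absurd (branch_eq_of_top (hbr _ h')) h
  have hone : ∀ v ∈ E.map (pendant i), (rooting p s).size S v = 1 := fun v hv => by
    obtain ⟨x, hx, rfl⟩ := Finset.mem_map.1 hv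
    exact (childClosed_iff i E).1 hE x hx
  have hsum := ParentMap.sum_size (T := rooting p s) S
  have hroot : (rooting p s).size S (branchRoot i) = α * 3 + 1 - m := by
    rw [show (rooting p s).root = center from rfl, Finset.sum_insert hc, hcenter,
      card_vertices hs] at hsum
    rw [hS, Finset.sum_insert hr, ← hS, Finset.sum_congr rfl hone] at hsum
    simp only [Finset.sum_const, Finset.card_map, hm, smul_eq_mul, mul_one] at hsum
    obtain ⟨m, rfl⟩ : ∃ m, n = m + 1 := ⟨n - 1, by have := i.2; omega⟩
    rw [Nat.add_sub_cancel, Nat.succ_mul] at hsum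
    omega
  rw [Finset.insert_val_of_notMem hc, Multiset.map_cons, hcenter, leafCutPartition]
  congr 1
  rw [hS, Finset.insert_val_of_notMem hr, ← hS, Multiset.map_cons, hroot]
  congr 1
  rw [Multiset.eq_replicate]
  refine ⟨by simp [hm], fun b hb => ?_⟩
  obtain ⟨v, hv, rfl⟩ := Multiset.mem_map.1 hb
  exact hone v hv

theorem exists_childClosed_of_sizes {α m : ℕ} (hs : ∀ i, p i + s i = α) (hn : 2 ≤ n)
    (hm : m + 3 ≤ α * 3) (hc : center ∉ S)
    (h : (insert center S).val.map ((rooting p s).size S) = leafCutPartition n α m) :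
    ∃ i, ∃ E : Finset (Pendant p s i), ChildClosed E ∧ E.card = m ∧
      insert (branchRoot i) (E.map (pendant i)) = S := by
  have hL : α * 3 + 1 < 1 + (n - 1) * (α * 3 + 1) := by
    have := Nat.le_mul_of_pos_left (α * 3 + 1) (show 0 < n - 1 by omega)
    omega
  have hcenter : (rooting p s).size S center = 1 + (n - 1) * (α * 3 + 1) := by
    have : 1 + (n - 1) * (α * 3 + 1) ∈ (insert center S).val.map ((rooting p s).size S) := by
      rw [h]
      exact Multiset.mem_cons_self _ _
    obtain ⟨v, -, hv⟩ := Multiset.mem_map.1 this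
    rcases vertex_cases v with rfl | ⟨i, rfl⟩ | ⟨i, x, rfl⟩
    · exact hv
    · have := size_branchRoot_le (S := S) i
      rw [hs] at this
      omega
    · have := size_pendant_le (S := S) i x
      omega
  rw [Finset.insert_val_of_notMem hc, Multiset.map_cons, hcenter, leafCutPartition,
    Multiset.cons_inj_right] at h
  obtain ⟨i, hi, hroot⟩ : ∃ i, branchRoot i ∈ S ∧
      (rooting p s).size S (branchRoot i) = α * 3 + 1 - m := by
    have : α * 3 + 1 - m ∈ S.val.map ((rooting p s).size S) := by
      rw [h]
      exact Multiset.mem_cons_self _ _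
    obtain ⟨v, hvS, hv⟩ := Multiset.mem_map.1 this
    rcases vertex_cases v with rfl | ⟨i, rfl⟩ | ⟨i, x, rfl⟩
    · exact absurd hvS hc
    · exact ⟨i, hvS, hv⟩
    · have := size_pendant_le (S := S) i x
      omega
  have hrest : (S.erase (branchRoot i)).val.map ((rooting p s).size S) =
      Multiset.replicate m 1 := by
    rw [← Finset.insert_erase hi, Finset.insert_val_of_notMem (Finset.notMem_erase _ _),
      Multiset.map_cons, Finset.insert_erase hi, hroot, Multiset.cons_inj_right] at h
    exact h
  obtain ⟨hcard, hone⟩ := Multiset.eq_replicate.1 hrest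
  have hcc : (Finset.univ.filter fun v => (rooting p s).top S v = center) =
      Finset.univ.filter fun v => branch v ≠ some i := by
    refine Finset.eq_of_subset_of_card_le (fun v hv => ?_) ?_
    · simp only [Finset.mem_filter, Finset.mem_univ, true_and] at hv ⊢
      intro hb
      have := branch_top hi hb
      rw [hv] at this
      cases this
    · rw [card_filter_branch_ne hs i, ← hcenter]
      rfl
  have hbr : ∀ v ∈ S, branch v = some i := fun v hv => by
    by_contra hb
    have hmem : v ∈ Finset.univ.filter fun v => (rooting p s).top S v = center := by
      rw [hcc]
      simpa using hb
    simp only [Finset.mem_filter, Finset.mem_univ, true_and] at hmem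
    rw [ParentMap.top_of_mem _ (Finset.mem_insert_of_mem hv)] at hmem
    exact hc (hmem ▸ hv)
  have hE : insert (branchRoot i)
      ((Finset.univ.filter fun x => pendant i x ∈ S).map (pendant i)) = S := by
    ext v
    simp only [Finset.mem_insert, Finset.mem_map, Finset.mem_filter, Finset.mem_univ, true_and]
    constructor
    · rintro (rfl | ⟨x, hx, rfl⟩)
      · exact hi
      · exact hx
    · intro hv
      rcases (branch_eq_some_iff v i).1 (hbr v hv) with h | ⟨x, rfl⟩
      · exact Or.inl h
      · exact Or.inr ⟨x, hv, rfl⟩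
  refine ⟨i, Finset.univ.filter fun x => pendant i x ∈ S, ?_, ?_, hE⟩
  · rw [childClosed_iff, hE]
    intro x hx
    refine hone _ (Multiset.mem_map_of_mem _ (Finset.mem_erase.2 ⟨?_, ?_⟩))
    · exact pendant_ne_branchRoot _ _ _
    · exact (Finset.mem_filter.1 hx).2
  · have := congrArg Finset.card hE
    rw [Finset.card_insert_of_notMem (by simp [pendant_ne_branchRoot]), Finset.card_map] at this
    rw [Multiset.card_map, Finset.card_val, Finset.card_erase_of_mem hi] at hcard
    omega

theorem count_leafCutPartition {α m : ℕ} (hs : ∀ i, p i + s i = α) (hn : 2 ≤ n)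
    (hm : m + 3 ≤ α * 3) :
    (UkPoly (TpsGraph n p s) (m + 1)).count (leafCutPartition n α m) =
      ∑ i, (Finset.univ.filter fun E : Finset (Pendant p s i) =>
        ChildClosed E ∧ E.card = m).card := by
  rw [rooting_isRootingOf.count_UkPoly (m + 1) _ (by simp [leafCutPartition]), ← Finset.card_sigma]
  symm
  refine Finset.card_bij (fun x _ => insert (branchRoot x.1) (x.2.map (pendant x.1))) ?_ ?_ ?_
  · rintro ⟨i, E⟩ hE
    simp only [Finset.mem_sigma, Finset.mem_filter, Finset.mem_univ, true_and] at hE ⊢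
    refine ⟨?_, sizes_of_childClosed hs i E hE.1 hE.2⟩
    change center ∉ _
    simp [pendant_ne_center]
  · rintro ⟨i, E⟩ - ⟨i', E'⟩ - h
    simp only at h
    have hi : (branchRoot i : Vtx n p s) ∈ insert (branchRoot i') (E'.map (pendant i')) := by
      rw [← h]
      exact Finset.mem_insert_self _ _
    obtain rfl : i = i' := by simpa [pendant_ne_branchRoot] using hi
    have h' := congrArg (fun A => A.erase (branchRoot i)) h
    rw [Finset.erase_insert (by simp [pendant_ne_branchRoot]),
      Finset.erase_insert (by simp [pendant_ne_branchRoot]), Finset.map_inj] at h'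
    rw [h']
  · intro S hS
    obtain ⟨hc, h⟩ := (Finset.mem_filter.1 hS).2
    obtain ⟨i, E, hE, hcard, rfl⟩ := exists_childClosed_of_sizes hs hn hm hc h
    exact ⟨⟨i, E⟩, by simp [hE, hcard], rfl⟩

open Polynomial

/-- A set of positions in a single copy of a path or star which is closed under taking children. -/
def PositionClosed {a b : ℕ} (j : Fin a ⊕ Fin b) (t : Finset (Fin 3)) : Prop :=
  ∀ l ∈ t, ∀ l', IsChild j l l' → l' ∈ t

theorem sum_positionClosed_inl {a b : ℕ} (j : Fin a) :
    ∑ t : Finset (Fin 3), (if PositionClosed (Sum.inl j : Fin a ⊕ Fin b) t then X ^ t.card else 0 :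
      ℤ[X]) = 1 + X + X ^ 2 + X ^ 3 := by
  rw [← Finset.sum_filter]
  have hmem : ∀ t, PositionClosed (Sum.inl j : Fin a ⊕ Fin b) t ↔
      t ∈ ({∅, {2}, {1, 2}, {0, 1, 2}} : Finset (Finset (Fin 3))) := by
    simp only [PositionClosed, IsChild]
    decide
  rw [Finset.filter_congr fun t _ => hmem t, Finset.filter_univ_mem,
    Finset.sum_insert (by decide), Finset.sum_insert (by decide),
    Finset.sum_insert (by decide), Finset.sum_singleton]
  simp
  ring

theorem sum_positionClosed_inr {a b : ℕ} (j : Fin b) :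
    ∑ t : Finset (Fin 3), (if PositionClosed (Sum.inr j : Fin a ⊕ Fin b) t then X ^ t.card else 0 :
      ℤ[X]) = 1 + 2 * X + X ^ 2 + X ^ 3 := by
  rw [← Finset.sum_filter]
  have hmem : ∀ t, PositionClosed (Sum.inr j : Fin a ⊕ Fin b) t ↔
      t ∈ ({∅, {1}, {2}, {1, 2}, {0, 1, 2}} : Finset (Finset (Fin 3))) := by
    simp only [PositionClosed, IsChild]
    decide
  rw [Finset.filter_congr fun t _ => hmem t, Finset.filter_univ_mem,
    Finset.sum_insert (by decide), Finset.sum_insert (by decide),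
    Finset.sum_insert (by decide), Finset.sum_insert (by decide), Finset.sum_singleton]
  simp
  ring

/-- A set of pairs as a family of sets. -/
def fiberEquiv (J L : Type) [Fintype J] [Fintype L] [DecidableEq J] [DecidableEq L] :
    Finset (J × L) ≃ (J → Finset L) where
  toFun E j := Finset.univ.filter fun l => (j, l) ∈ E
  invFun D := Finset.univ.filter fun x => x.2 ∈ D x.1
  left_inv E := by ext; simp
  right_inv D := by ext; simp

theorem sum_card_fiberEquiv {J L : Type} [Fintype J] [Fintype L] [DecidableEq J] [DecidableEq L]
    (E : Finset (J × L)) : ∑ j, (fiberEquiv J L E j).card = E.card := by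
  rw [Finset.card_eq_sum_card_fiberwise (f := Prod.fst) (t := Finset.univ) (by simp)]
  refine Finset.sum_congr rfl fun j _ => ?_
  refine Finset.card_bij (fun l _ => (j, l)) ?_ ?_ ?_
  · intro l hl
    simpa [fiberEquiv] using hl
  · intro l _ l' _ h
    exact (Prod.mk.inj h).2
  · rintro ⟨j', l⟩ h
    obtain ⟨h, rfl⟩ := Finset.mem_filter.1 h
    exact ⟨l, by simpa [fiberEquiv] using h, rfl⟩

theorem card_childClosed (a b m : ℕ) :
    ((Finset.univ.filter fun E : Finset ((Fin a ⊕ Fin b) × Fin 3) =>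
      ChildClosed E ∧ E.card = m).card : ℤ) =
      ((1 + X + X ^ 2 + X ^ 3) ^ a * (1 + 2 * X + X ^ 2 + X ^ 3) ^ b : ℤ[X]).coeff m := by
  have hprod : ((1 + X + X ^ 2 + X ^ 3) ^ a * (1 + 2 * X + X ^ 2 + X ^ 3) ^ b : ℤ[X]) =
      ∏ j : Fin a ⊕ Fin b, ∑ t : Finset (Fin 3),
        (if PositionClosed j t then X ^ t.card else 0) := by
    rw [Fintype.prod_sum_type]
    simp only [sum_positionClosed_inl, sum_positionClosed_inr, Finset.prod_const,
      Finset.card_univ, Fintype.card_fin]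
  have hclosed : ∀ E : Finset ((Fin a ⊕ Fin b) × Fin 3),
      ChildClosed E ↔ ∀ j ∈ Finset.univ, PositionClosed j (fiberEquiv _ _ E j) := fun E => by
    simp [ChildClosed, PositionClosed, fiberEquiv]
  rw [hprod, Finset.prod_univ_sum, Fintype.piFinset_univ,
    ← (fiberEquiv (Fin a ⊕ Fin b) (Fin 3)).sum_comp, finsetSum_coeff, Finset.card_filter,
    Nat.cast_sum]
  refine Finset.sum_congr rfl fun E _ => ?_
  rw [Finset.prod_ite_zero, Finset.prod_pow_eq_pow_sum, sum_card_fiberEquiv]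
  by_cases h : ChildClosed E
  · rw [if_pos ((hclosed E).1 h), coeff_X_pow]
    simp [h, eq_comm]
  · rw [if_neg fun h' => h ((hclosed E).2 h')]
    simp [h]

theorem coeff_childClosed_polynomial {α m : ℕ} {a : ℕ} (ha : a ≤ α) :
    ((1 + X + X ^ 2 + X ^ 3) ^ a * (1 + 2 * X + X ^ 2 + X ^ 3) ^ (α - a) : ℤ[X]).coeff m =
      ∑ j ∈ Finset.range (α + 1), (-1) ^ j *
        ((X ^ j * (1 + 2 * X + X ^ 2 + X ^ 3) ^ (α - j) : ℤ[X]).coeff m) * (a.choose j : ℤ) := by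
  rw [← Finset.sum_subset (Finset.range_mono (Nat.succ_le_succ ha)) fun j _ hj => by
    rw [Nat.choose_eq_zero_of_lt (by simpa using hj)]; simp]
  rw [show (1 + X + X ^ 2 + X ^ 3 : ℤ[X]) = -X + (1 + 2 * X + X ^ 2 + X ^ 3) by ring, add_pow,
    Finset.sum_mul, finsetSum_coeff]
  refine Finset.sum_congr rfl fun j hj => ?_
  have hj' : j ≤ a := by simpa [Nat.lt_succ_iff] using hj
  rw [show α - j = a - j + (α - a) by omega, pow_add, neg_pow,
    ← coeff_C_mul, ← coeff_mul_C]
  congr 1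
  simp only [map_pow, map_neg, map_one, map_natCast]
  ring

end PTETree

section PowerSums

open Polynomial

variable {k n : ℕ} {p p' : Fin n → ℕ}

theorem PTErel.sum_eval_eq (h : PTErel k p p') {f : ℤ[X]} (hf : f.natDegree ≤ k) :
    ∑ i, f.eval (p i : ℤ) = ∑ i, f.eval (p' i : ℤ) := by
  have key : ∀ q : Fin n → ℕ, ∑ i, f.eval (q i : ℤ) =
      ∑ l ∈ Finset.range (k + 1), f.coeff l * ∑ i, (q i : ℤ) ^ l := fun q => by
    simp only [Finset.mul_sum]
    rw [Finset.sum_comm]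
    exact Finset.sum_congr rfl fun i _ => eval_eq_sum_range' (Nat.lt_succ_of_le hf) _
  rw [key, key]
  refine Finset.sum_congr rfl fun l hl => ?_
  rcases Nat.eq_zero_or_pos l with rfl | hl0
  · simp
  · have := h l hl0 (Nat.lt_succ_iff.1 (Finset.mem_range.1 hl))
    rw [show ∑ i, (p i : ℤ) ^ l = ∑ i, (p' i : ℤ) ^ l by exact_mod_cast this]

theorem eval_descPochhammer_eq_factorial_mul_choose (a j : ℕ) :
    (descPochhammer ℤ j).eval (a : ℤ) = j.factorial * (a.choose j : ℤ) := by
  rw [descPochhammer_eval_eq_descFactorial, Nat.descFactorial_eq_factorial_mul_choose]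
  push_cast
  rfl

theorem PTErel.sum_choose_eq (h : PTErel k p p') {j : ℕ} (hj : j ≤ k) :
    ∑ i, ((p i).choose j : ℤ) = ∑ i, ((p' i).choose j : ℤ) := by
  have := h.sum_eval_eq (f := descPochhammer ℤ j) (by rwa [descPochhammer_natDegree])
  simp only [eval_descPochhammer_eq_factorial_mul_choose, ← Finset.mul_sum] at this
  exact mul_left_cancel₀ (by exact_mod_cast j.factorial_ne_zero) this

theorem PTErel.sum_choose_ne (h : PTErel k p p')
    (hne : ∑ i, p i ^ (k + 1) ≠ ∑ i, p' i ^ (k + 1)) :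
    ∑ i, ((p i).choose (k + 1) : ℤ) ≠ ∑ i, ((p' i).choose (k + 1) : ℤ) := by
  intro heq
  have hdeg : (descPochhammer ℤ (k + 1) - X ^ (k + 1)).natDegree ≤ k := by
    have hd : (descPochhammer ℤ (k + 1)).degree = ((k + 1 : ℕ) : WithBot ℕ) := by
      rw [degree_eq_natDegree (monic_descPochhammer ℤ _).ne_zero, descPochhammer_natDegree]
    have hlt : (descPochhammer ℤ (k + 1) - X ^ (k + 1)).degree < ((k + 1 : ℕ) : WithBot ℕ) := by
      have := degree_sub_lt_left (q := (X ^ (k + 1) : ℤ[X])) (hd.trans (degree_X_pow _).symm)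
        (monic_descPochhammer ℤ _).ne_zero
        ((monic_descPochhammer ℤ _).leadingCoeff.trans (monic_X_pow _).leadingCoeff.symm)
      rwa [hd] at this
    exact natDegree_le_iff_coeff_eq_zero.2 fun N hN =>
      coeff_eq_zero_of_degree_lt (hlt.trans_le (by exact_mod_cast hN))
  have := h.sum_eval_eq hdeg
  simp only [eval_sub, eval_pow, eval_X, eval_descPochhammer_eq_factorial_mul_choose,
    Finset.sum_sub_distrib, ← Finset.mul_sum, heq] at this
  exact hne (by exact_mod_cast sub_right_injective this)

end PowerSums

/-- If `p =_k p'` are `α`-compatible sequences whose `(k+1)`-st power sums differ, then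
the trees `T_α(p)` and `T_α(p')` have different `U_{k+2}`-polynomials. -/
theorem different_Uk_of_different_power_sums (k α n : ℕ) (hk : 0 < k) (hα : 0 < α)
    (p p' : Fin n → ℕ) (hp : AlphaCompatible α p) (hp' : AlphaCompatible α p')
    (hpte : PTErel k p p')
    (hne : ∑ i, (p i) ^ (k + 1) ≠ ∑ i, (p' i) ^ (k + 1)) :
    UkPoly (Ttree α p) (k + 2) ≠ UkPoly (Ttree α p') (k + 2) := by
  obtain ⟨hn, hpα⟩ := hp
  obtain ⟨-, hpα'⟩ := hp'
  have hchoose := hpte.sum_choose_ne hne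
  have hkα : k + 1 ≤ α := by
    by_contra hlt
    refine hchoose ?_
    refine (Finset.sum_eq_zero fun i _ => ?_).trans (Finset.sum_eq_zero fun i _ => ?_).symm
    · rw [Nat.choose_eq_zero_of_lt (by have := hpα i; omega), Nat.cast_zero]
    · rw [Nat.choose_eq_zero_of_lt (by have := hpα' i; omega), Nat.cast_zero]
  let c : ℕ → ℤ := fun j => (-1) ^ j * ((Polynomial.X ^ j * (1 + 2 * Polynomial.X +
    Polynomial.X ^ 2 + Polynomial.X ^ 3) ^ (α - j) : Polynomial ℤ).coeff (k + 1))
  have hcount : ∀ q : Fin n → ℕ, (∀ i, q i ≤ α) →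
      ((UkPoly (Ttree α q) (k + 2)).count (PTETree.leafCutPartition n α (k + 1)) : ℤ) =
        ∑ j ∈ Finset.range (α + 1), c j * ∑ i, ((q i).choose j : ℤ) := by
    intro q hq
    rw [Ttree, PTETree.count_leafCutPartition (fun i => Nat.add_sub_cancel' (hq i)) hn (by omega),
      Nat.cast_sum]
    simp only [Finset.mul_sum]
    rw [Finset.sum_comm]
    refine Finset.sum_congr rfl fun i _ => ?_
    rw [PTETree.card_childClosed, PTETree.coeff_childClosed_polynomial (hq i)]
  intro heq
  have h0 := hcount p hpα
  rw [heq, hcount p' hpα', ← sub_eq_zero, ← Finset.sum_sub_distrib,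
    Finset.sum_eq_single (k + 1)] at h0
  · have hc : c (k + 1) = (-1) ^ (k + 1) := by
      simp [c, Polynomial.coeff_X_pow_mul', Polynomial.coeff_zero_eq_eval_zero]
    rw [hc, ← mul_sub] at h0
    rcases mul_eq_zero.1 h0 with h | h
    · exact pow_ne_zero _ (by norm_num) h
    · exact hchoose (sub_eq_zero.1 h).symm
  · intro j _ hj
    rcases lt_or_gt_of_ne hj with hj | hj
    · rw [hpte.sum_choose_eq (Nat.lt_succ_iff.1 hj), sub_self]
    · have hc : c j = 0 := by
        simp [c, Polynomial.coeff_X_pow_mul', Nat.not_le.2 hj]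
      rw [hc, zero_mul, zero_mul, sub_zero]
  · intro h
    exact absurd (Finset.mem_range.2 (by omega)) h
end

section
/- For every positive integer k and every integer j ≥ 2, there exist j integer sequences a_1, a_2, …, a_j, all of the same length n with n ≤ (k²+k+2)/2, pairwise distinct up to permutation of their entries, such that a_1 =_k a_2 =_k ⋯ =_k a_j (i.e. for every pair i, i' and every 1 ≤ ℓ ≤ k, the sums of the ℓ-th powers of the entries of a_i and of a_{i'} are equal). -/
open scoped Classical

/-- Sequences whose `i`-th entry lies in the block `[i N, (i + 1) N)` are determined by their
multiset of entries. -/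
lemma eq_of_map_block_eq {n N : ℕ} {f g : Fin n → Fin N}
    (h : Multiset.map (fun i : Fin n => (((i : ℕ) * N + (f i : ℕ) : ℕ) : ℤ)) Finset.univ.val =
      Multiset.map (fun i : Fin n => (((i : ℕ) * N + (g i : ℕ) : ℕ) : ℤ)) Finset.univ.val) :
    f = g := by
  funext i
  have hmem := Multiset.mem_map_of_mem
    (fun i : Fin n => (((i : ℕ) * N + (f i : ℕ) : ℕ) : ℤ)) (Finset.mem_univ_val i)
  rw [h, Multiset.mem_map] at hmem
  obtain ⟨i', -, hi'⟩ := hmem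
  have heq : (i' : ℕ) * N + (g i' : ℕ) = (i : ℕ) * N + (f i : ℕ) := by exact_mod_cast hi'
  have hN : 0 < N := (f i).pos
  have hdiv := congrArg (· / N) heq
  simp only [mul_comm _ N, Nat.mul_add_div hN,
    Nat.div_eq_of_lt (f i).isLt, Nat.div_eq_of_lt (g i').isLt, add_zero] at hdiv
  obtain rfl : i' = i := Fin.ext hdiv
  exact Fin.ext (by omega)

/-- The `ℓ`-th power sum of `n` natural numbers below `M` is less than `n * M ^ ℓ`. -/
lemma sum_pow_lt_mul_pow {n M ℓ : ℕ} (hn : 0 < n) (hℓ : ℓ ≠ 0) {b : Fin n → ℕ}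
    (hb : ∀ i, b i < M) : ∑ i, b i ^ ℓ < n * M ^ ℓ := by
  have : Nonempty (Fin n) := ⟨⟨0, hn⟩⟩
  calc ∑ i, b i ^ ℓ < ∑ _i : Fin n, M ^ ℓ :=
        Finset.sum_lt_sum_of_nonempty Finset.univ_nonempty
          fun i _ => Nat.pow_lt_pow_left (hb i) hℓ
    _ = n * M ^ ℓ := by simp

/-- For every positive integer `k` and every `j ≥ 2` there exist `j` integer sequences,
all of the same length `n ≤ (k² + k + 2)/2`, pairwise distinct up to permutation of
their entries, that are pairwise `=_k`-equivalent. -/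
theorem exists_many_PTE_solutions (k j : ℕ) (hk : 0 < k) (hj : 2 ≤ j) :
    ∃ (n : ℕ) (a : Fin j → Fin n → ℤ),
      n ≤ (k ^ 2 + k + 2) / 2 ∧
      (∀ i i' : Fin j, i ≠ i' →
        Multiset.map (a i) Finset.univ.val ≠ Multiset.map (a i') Finset.univ.val) ∧
      (∀ i i' : Fin j, PTErel k (a i) (a i')) := by
  obtain ⟨S, hS⟩ : ∃ S, S = ∑ ℓ : Fin k, ((ℓ : ℕ) + 1) := ⟨_, rfl⟩
  have hS2 : S * 2 = k ^ 2 + k := by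
    have h := Finset.sum_range_id_mul_two (k + 1)
    rw [Finset.sum_range_succ', add_zero, ← Fin.sum_univ_eq_sum_range (fun ℓ => ℓ + 1), ← hS] at h
    rw [h, Nat.add_sub_cancel]
    ring
  obtain ⟨n, hn⟩ : ∃ n, n = S + 1 := ⟨_, rfl⟩
  have hn0 : 0 < n := by omega
  obtain ⟨N, hN⟩ : ∃ N, N = n ^ k * n ^ S * (j + 1) := ⟨_, rfl⟩
  have hN0 : 0 < N := by rw [hN]; positivity
  let b : (Fin n → Fin N) → Fin n → ℕ := fun f i => (i : ℕ) * N + (f i : ℕ)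
  have hb : ∀ f i, b f i < n * N := fun f i =>
    calc (i : ℕ) * N + (f i : ℕ) < (i : ℕ) * N + N := Nat.add_lt_add_left (f i).isLt _
      _ = ((i : ℕ) + 1) * N := by ring
      _ ≤ n * N := Nat.mul_le_mul_right _ i.isLt
  let φ : (Fin n → Fin N) → (ℓ : Fin k) → Fin (n * (n * N) ^ ((ℓ : ℕ) + 1)) :=
    fun f ℓ => ⟨∑ i, b f i ^ ((ℓ : ℕ) + 1), sum_pow_lt_mul_pow hn0 ℓ.val.succ_ne_zero (hb f)⟩
  have hcard : Fintype.card ((ℓ : Fin k) → Fin (n * (n * N) ^ ((ℓ : ℕ) + 1))) * j <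
      Fintype.card (Fin n → Fin N) := by
    simp only [Fintype.card_pi, Fintype.card_fin, Finset.prod_mul_distrib, Finset.prod_const,
      Finset.card_univ, Finset.prod_pow_eq_pow_sum, ← hS]
    calc n ^ k * (n * N) ^ S * j = N ^ S * (n ^ k * n ^ S * j) := by ring
      _ < N ^ S * N := by
        refine Nat.mul_lt_mul_of_pos_left ?_ (by positivity)
        rw [hN]
        exact Nat.mul_lt_mul_of_pos_left j.lt_succ_self (by positivity)
      _ = N ^ n := by rw [hn, pow_succ]
  obtain ⟨y, hy⟩ := Fintype.exists_lt_card_fiber_of_mul_lt_card φ hcard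
  obtain ⟨T, hT, hTj⟩ := Finset.exists_subset_card_eq hy.le
  let e := (T.equivFinOfCardEq hTj).symm
  refine ⟨n, fun m i => (b (e m) i : ℤ), by omega, fun m m' hne h => ?_, fun m m' ℓ h1 h2 => ?_⟩
  · exact hne (e.injective (Subtype.ext (eq_of_map_block_eq h)))
  · have hφ : ∀ m, φ (e m) = y := fun m => (Finset.mem_filter.mp (hT (e m).2)).2
    have h := congrArg Fin.val (congrFun ((hφ m).trans (hφ m').symm) ⟨ℓ - 1, by omega⟩)
    simp only [φ, Nat.sub_add_cancel h1] at h
    beta_reduce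
    exact_mod_cast h
end
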